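/- Let α ∈ (0,1) and let n be a positive integer. Suppose f : [0,1] → ℝ is n times differentiable with f^{(j)}(0) = f^{(j)}(1) = 0 for all 0 ≤ j ≤ n−1, and suppose f^{(n)} is locally Lipschitz on (0,1) and belongs to L¹_{1−α}((0,1)). Then for every x ∈ (0,1) both D_{α+n}(f)(x) and D_α(f^{(n)})(x) exist and D_{α+n}(f)(x) = 2^n · D_α(f^{(n)})(x). -/

import Mathlib

open MeasureTheory Filter Asymptotics

/-- The `m`-th Fourier coefficient of `φ_β(θ) = (1-e^{iθ})^β (1+e^{-iθ})^β`
(principal branch complex powers). -/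
noncomputable def phiHat (β : ℝ) (n : ℤ) : ℂ :=
  (1 / (2 * (Real.pi : ℂ))) * ∫ θ in (-Real.pi)..Real.pi,
    (1 - Complex.exp ((θ : ℂ) * Complex.I)) ^ (β : ℂ) *
      (1 + Complex.exp (-(θ : ℂ) * Complex.I)) ^ (β : ℂ) *
      Complex.exp (-(n : ℂ) * (θ : ℂ) * Complex.I)

/-- The discretization vector `X_{N,l}`: `g(l/N)` for `0 < l < N`, and `0` at the endpoints. -/
noncomputable def Xvec (g : ℝ → ℝ) (N l : ℕ) : ℝ :=
  if l = 0 ∨ l = N then 0 else g ((l : ℝ) / (N : ℝ))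

/-- `g` is `β`-differentiable at `x` with derivative `L`. -/
def HasDAt (β : ℝ) (g : ℝ → ℝ) (x : ℝ) (L : ℂ) : Prop :=
  Tendsto
    (fun N : ℕ => (((N : ℝ) ^ β : ℝ) : ℂ) *
      ∑ l ∈ Finset.range (N + 1), phiHat β (⌊(N : ℝ) * x⌋ - (l : ℤ)) * ((Xvec g N l : ℝ) : ℂ))
    atTop (nhds L)

/-- `g` is locally Lipschitz (locally contracting) on `(0,1)`. -/
def LocLip01 (g : ℝ → ℝ) : Prop :=
  ∀ a b : ℝ, 0 < a → a ≤ b → b < 1 →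
    ∃ K : ℝ, ∀ z ∈ Set.Icc a b, ∀ z' ∈ Set.Icc a b, |g z - g z'| ≤ K * |z - z'|

/-- `g` belongs to the class `L¹_{1-α}((0,1))`. -/
def MemL1Class (α : ℝ) (g : ℝ → ℝ) : Prop :=
  ∃ γ : ℝ, 0 ≤ γ ∧ γ ≤ 1 - α ∧
    (g =O[nhdsWithin 0 (Set.Ioi 0)] fun t : ℝ => t ^ (-γ)) ∧
    ((fun t : ℝ => g (1 - t)) =O[nhdsWithin 0 (Set.Ioi 0)] fun t : ℝ => t ^ (-γ))

/-- The symbol whose Fourier coefficients are `phiHat β`. -/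
noncomputable def phiSymbol (β θ : ℝ) : ℂ :=
  (1 - Complex.exp ((θ : ℂ) * Complex.I)) ^ (β : ℂ) *
    (1 + Complex.exp (-(θ : ℂ) * Complex.I)) ^ (β : ℂ)

lemma one_sub_exp_re (θ : ℝ) : (1 - Complex.exp ((θ : ℂ) * Complex.I)).re = 1 - Real.cos θ := by
  simp [Complex.exp_ofReal_mul_I_re]

lemma one_add_exp_re (θ : ℝ) : (1 + Complex.exp (-(θ : ℂ) * Complex.I)).re = 1 + Real.cos θ := by
  have := Complex.exp_ofReal_mul_I_re (-θ)
  push_cast at this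
  simp [-neg_mul, this]

lemma continuous_phiSymbol {β : ℝ} (hβ : 0 < β) : Continuous (phiSymbol β) := by
  have hβ' : 0 < (β : ℂ).re := by simpa
  refine Continuous.mul ?_ ?_ <;> rw [continuous_iff_continuousAt] <;> intro θ
  · refine ContinuousAt.comp (f := fun θ : ℝ => 1 - Complex.exp ((θ : ℂ) * Complex.I))
      (g := fun z : ℂ => z ^ (β : ℂ))
      (Complex.continuousAt_cpow_const_of_re_pos (Or.inl ?_) hβ') (by fun_prop)
    rw [one_sub_exp_re]; linarith [Real.cos_le_one θ]
  · refine ContinuousAt.comp (f := fun θ : ℝ => 1 + Complex.exp (-(θ : ℂ) * Complex.I))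
      (g := fun z : ℂ => z ^ (β : ℂ))
      (Complex.continuousAt_cpow_const_of_re_pos (Or.inl ?_) hβ') (by fun_prop)
    rw [one_add_exp_re]; linarith [Real.neg_one_le_cos θ]

lemma phiHat_eq (β : ℝ) (m : ℤ) :
    phiHat β m = (1 / (2 * (Real.pi : ℂ))) * ∫ θ in (-Real.pi)..Real.pi,
      phiSymbol β θ * Complex.exp (-(m : ℂ) * (θ : ℂ) * Complex.I) := rfl

lemma phiSymbol_mul_exp_intervalIntegrable {β : ℝ} (hβ : 0 < β) (m : ℤ) (a b : ℝ) :
    IntervalIntegrable (fun θ : ℝ => phiSymbol β θ *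
      Complex.exp (-(m : ℂ) * (θ : ℂ) * Complex.I)) volume a b :=
  Continuous.intervalIntegrable ((continuous_phiSymbol hβ).mul (by fun_prop)) _ _

lemma cpow_add_one_of_pos {β : ℝ} (hβ : 0 < β) (z : ℂ) :
    z ^ ((β + 1 : ℝ) : ℂ) = z ^ (β : ℂ) * z := by
  rcases eq_or_ne z 0 with rfl | hz
  · rw [Complex.zero_cpow (by exact_mod_cast (by linarith : β + 1 ≠ 0)), mul_zero]
  · push_cast
    rw [Complex.cpow_add _ _ hz, Complex.cpow_one]

lemma phiSymbol_add_one {β : ℝ} (hβ : 0 < β) (θ : ℝ) :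
    phiSymbol (β + 1) θ = phiSymbol β θ *
      (Complex.exp (-(θ : ℂ) * Complex.I) - Complex.exp ((θ : ℂ) * Complex.I)) := by
  have h : Complex.exp ((θ : ℂ) * Complex.I) * Complex.exp (-(θ : ℂ) * Complex.I) = 1 := by
    rw [← Complex.exp_add]; simp
  rw [phiSymbol, phiSymbol, cpow_add_one_of_pos hβ, cpow_add_one_of_pos hβ]
  linear_combination (-(1 - Complex.exp ((θ : ℂ) * Complex.I)) ^ (β : ℂ) *
    (1 + Complex.exp (-(θ : ℂ) * Complex.I)) ^ (β : ℂ)) * h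

/-- Raising the order by one amounts to a central difference of the coefficients. -/
lemma phiHat_add_one {β : ℝ} (hβ : 0 < β) (m : ℤ) :
    phiHat (β + 1) m = phiHat β (m + 1) - phiHat β (m - 1) := by
  simp only [phiHat_eq]
  rw [← mul_sub, ← intervalIntegral.integral_sub
    (phiSymbol_mul_exp_intervalIntegrable hβ _ _ _) (phiSymbol_mul_exp_intervalIntegrable hβ _ _ _)]
  congr 2
  ext θ
  rw [phiSymbol_add_one hβ, mul_assoc, sub_mul, ← Complex.exp_add, ← Complex.exp_add, ← mul_sub]
  push_cast
  ring_nf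

lemma phiSymbol_pi {β : ℝ} (hβ : 0 < β) : phiSymbol β Real.pi = 0 := by
  have : (1 + Complex.exp (-(Real.pi : ℂ) * Complex.I)) = 0 := by
    rw [neg_mul, Complex.exp_neg, Complex.exp_pi_mul_I]; norm_num
  rw [phiSymbol, this, Complex.zero_cpow (by exact_mod_cast hβ.ne'), mul_zero]

lemma phiSymbol_neg_pi {β : ℝ} (hβ : 0 < β) : phiSymbol β (-Real.pi) = 0 := by
  have : (1 + Complex.exp (-((-Real.pi : ℝ) : ℂ) * Complex.I)) = 0 := by
    push_cast
    rw [neg_neg, Complex.exp_pi_mul_I]; norm_num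
  rw [phiSymbol, this, Complex.zero_cpow (by exact_mod_cast hβ.ne'), mul_zero]

lemma hasDerivAt_phiSymbol {β θ : ℝ} (h1 : 0 < 1 - Real.cos θ)
    (h2 : 0 < 1 + Real.cos θ) :
    HasDerivAt (phiSymbol (β + 1)) ((β + 1) * phiSymbol β θ * (-Complex.I *
      (Complex.exp (-(θ : ℂ) * Complex.I) + Complex.exp ((θ : ℂ) * Complex.I)))) θ := by
  have hid : HasDerivAt (fun t : ℝ => (t : ℂ)) 1 θ := Complex.ofRealCLM.hasDerivAt
  have hA : HasDerivAt (fun t : ℝ => 1 - Complex.exp ((t : ℂ) * Complex.I))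
      (-(Complex.exp ((θ : ℂ) * Complex.I) * (1 * Complex.I))) θ :=
    ((hid.mul_const Complex.I).cexp).const_sub 1
  have hB : HasDerivAt (fun t : ℝ => 1 + Complex.exp (-(t : ℂ) * Complex.I))
      (Complex.exp (-(θ : ℂ) * Complex.I) * (-1 * Complex.I)) θ :=
    ((hid.neg.mul_const Complex.I).cexp).const_add 1
  have hsA : 1 - Complex.exp ((θ : ℂ) * Complex.I) ∈ Complex.slitPlane :=
    Or.inl (by rwa [one_sub_exp_re])
  have hsB : 1 + Complex.exp (-(θ : ℂ) * Complex.I) ∈ Complex.slitPlane :=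
    Or.inl (by rwa [one_add_exp_re])
  have hA' := (Complex.hasStrictDerivAt_cpow_const (c := ((β + 1 : ℝ) : ℂ)) hsA).hasDerivAt.comp θ hA
  have hB' := (Complex.hasStrictDerivAt_cpow_const (c := ((β + 1 : ℝ) : ℂ)) hsB).hasDerivAt.comp θ hB
  have e1 : ((β + 1 : ℝ) : ℂ) - 1 = (β : ℂ) := by push_cast; ring
  have e2 : ∀ z ∈ Complex.slitPlane, z ^ ((β + 1 : ℝ) : ℂ) = z ^ (β : ℂ) * z := fun z hz => by
    push_cast
    rw [Complex.cpow_add _ _ (Complex.slitPlane_ne_zero hz), Complex.cpow_one]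
  have h : Complex.exp ((θ : ℂ) * Complex.I) * Complex.exp (-(θ : ℂ) * Complex.I) = 1 := by
    rw [← Complex.exp_add]; simp
  refine (hA'.mul hB').congr_deriv ?_
  simp only [Function.comp_apply]
  rw [e1, e2 _ hsA, e2 _ hsB, phiSymbol]
  push_cast
  ring

/-- Two-step recurrence for the coefficients, from integration by parts. -/
lemma phiHat_recurrence {β : ℝ} (hβ : 0 < β) (m : ℤ) :
    ((m : ℂ) + 2 + β) * phiHat β (m + 2) = ((m : ℂ) - β) * phiHat β m := by
  have hpi := Real.pi_pos
  set e : ℤ → ℝ → ℂ := fun m θ => Complex.exp (-(m : ℂ) * (θ : ℂ) * Complex.I) with he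
  have hint := fun m => phiSymbol_mul_exp_intervalIntegrable hβ m (-Real.pi) Real.pi
  have hint' := phiSymbol_mul_exp_intervalIntegrable (by linarith : 0 < β + 1) (m + 1)
    (-Real.pi) Real.pi
  have hde : ∀ θ, HasDerivAt (e (m + 1)) (e (m + 1) θ * (-((m + 1 : ℤ) : ℂ) * 1 * Complex.I)) θ :=
    fun θ => (((Complex.ofRealCLM.hasDerivAt (x := θ)).const_mul _).mul_const Complex.I).cexp
  have key := integral_eq_of_hasDerivAt_off_countable
    (a := -Real.pi) (b := Real.pi) (s := {0})
    (fun θ : ℝ => phiSymbol (β + 1) θ * e (m + 1) θ)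
    (fun θ : ℝ => -Complex.I * (β + 1) * (phiSymbol β θ * e (m + 2) θ + phiSymbol β θ * e m θ) +
      (-((m + 1 : ℤ) : ℂ) * Complex.I) * (phiSymbol (β + 1) θ * e (m + 1) θ))
    (Set.countable_singleton 0)
    (((continuous_phiSymbol (by linarith)).mul (by fun_prop)).continuousOn) ?_
    ((((hint (m + 2)).add (hint m)).const_mul _).add (hint'.const_mul _))
  · rw [intervalIntegral.integral_add (((hint (m + 2)).add (hint m)).const_mul _)
      (hint'.const_mul _), intervalIntegral.integral_const_mul, intervalIntegral.integral_const_mul,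
      intervalIntegral.integral_add (hint (m + 2)) (hint m),
      phiSymbol_pi (by linarith), phiSymbol_neg_pi (by linarith)] at key
    have h1 := phiHat_add_one hβ (m + 1)
    rw [show m + 1 + 1 = m + 2 by ring, show m + 1 - 1 = m by ring] at h1
    have key2 : -Complex.I * (β + 1) * (phiHat β (m + 2) + phiHat β m) +
      (-((m + 1 : ℤ) : ℂ) * Complex.I) * phiHat (β + 1) (m + 1) = 0 := by
      simp only [phiHat_eq]
      linear_combination (1 / (2 * (Real.pi : ℂ))) * key
    rw [h1] at key2
    push_cast at key2
    linear_combination Complex.I * key2 + (-((m : ℂ) + 2 + β) * phiHat β (m + 2) +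
      ((m : ℂ) - β) * phiHat β m) * -(Complex.I_mul_I)
  · rintro θ ⟨hθ, hθ0⟩
    rw [min_eq_left (by linarith), max_eq_right (by linarith)] at hθ
    have hs : Real.sin θ ≠ 0 := by
      intro h
      rw [Real.sin_eq_zero_iff_of_lt_of_lt hθ.1 hθ.2] at h
      exact hθ0 h
    have hs2 : 0 < Real.sin θ ^ 2 := by positivity
    have hsc := Real.sin_sq_add_cos_sq θ
    have := (hasDerivAt_phiSymbol (β := β) (θ := θ) (by nlinarith [Real.neg_one_le_cos θ])
      (by nlinarith [Real.cos_le_one θ])).mul (hde θ)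
    refine this.congr_deriv ?_
    have e1 : e (m + 2) θ = e (m + 1) θ * Complex.exp (-(θ : ℂ) * Complex.I) := by
      simp only [he]; rw [← Complex.exp_add]; push_cast; ring_nf
    have e2 : e m θ = e (m + 1) θ * Complex.exp ((θ : ℂ) * Complex.I) := by
      simp only [he]; rw [← Complex.exp_add]; push_cast; ring_nf
    rw [e1, e2]
    ring

lemma exists_tendsto_of_ratio_mem_Icc {b : ℕ → ℂ} {r : ℕ → ℝ} (h0 : ∀ j, 0 ≤ r j)
    (h1 : ∀ j, r j ≤ 1) (hb : ∀ j, b (j + 1) = r j * b j) :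
    ∃ c, Tendsto b atTop (nhds c) := by
  have hnn : ∀ n, 0 ≤ ∏ i ∈ Finset.range n, r i := fun n => Finset.prod_nonneg fun i _ => h0 i
  have hanti : Antitone fun n => ∏ i ∈ Finset.range n, r i := by
    refine antitone_nat_of_succ_le fun n => ?_
    rw [Finset.prod_range_succ]
    exact mul_le_of_le_one_right (hnn n) (h1 n)
  have hlim := tendsto_atTop_ciInf hanti ⟨0, by rintro _ ⟨n, rfl⟩; exact hnn n⟩
  have hform : ∀ n, b n = ((∏ i ∈ Finset.range n, r i : ℝ) : ℂ) * b 0 := by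
    intro n
    induction n with
    | zero => simp
    | succ n ih => rw [hb, ih, Finset.prod_range_succ]; push_cast; ring
  exact ⟨_, (((Complex.continuous_ofReal.tendsto _).comp hlim).mul_const (b 0)).congr
    fun n => (hform n).symm⟩

lemma tendsto_of_tendsto_odd_even {d : ℕ → ℂ} {c : ℂ}
    (h1 : Tendsto (fun j => d (2 * j + 1)) atTop (nhds c))
    (h2 : Tendsto (fun j => d (2 * j + 2)) atTop (nhds c)) : Tendsto d atTop (nhds c) := by
  rw [Metric.tendsto_atTop] at *
  intro ε hε
  obtain ⟨M1, hM1⟩ := h1 ε hε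
  obtain ⟨M2, hM2⟩ := h2 ε hε
  refine ⟨2 * M1 + 2 * M2 + 2, fun n hn => ?_⟩
  rcases Nat.even_or_odd' n with ⟨j, rfl | rfl⟩
  · have := hM2 (j - 1) (by omega)
    rwa [show 2 * (j - 1) + 2 = 2 * j by omega] at this
  · exact hM1 j (by omega)

/-- The two-step recurrence satisfied by the coefficients of both signs. -/
def TwoStepRec (α : ℝ) (ψ : ℕ → ℂ) : Prop :=
  ∀ p : ℕ, ((p : ℂ) + 2 + α) * ψ (p + 2) = ((p : ℂ) - α) * ψ p

/-- The ratio of consecutive terms of `ψ p * (p + α) ^ (1 + α)` under `TwoStepRec α ψ`. -/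
noncomputable def stepRatio (α : ℝ) (p : ℕ) : ℝ :=
  ((p : ℝ) - α) / (p + 2 + α) * ((p + 2 + α) / (p + α)) ^ (1 + α)

lemma stepRatio_nonneg {α : ℝ} (hα : α ∈ Set.Ioo (0 : ℝ) 1) {p : ℕ} (hp : 1 ≤ p) :
    0 ≤ stepRatio α p := by
  have h1 : (1 : ℝ) ≤ p := by exact_mod_cast hp
  have := hα.1
  have := hα.2
  have : 0 ≤ (p : ℝ) - α := by linarith
  unfold stepRatio
  positivity

lemma stepRatio_le_one {α : ℝ} (hα : α ∈ Set.Ioo (0 : ℝ) 1) (p : ℕ) :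
    stepRatio α p ≤ 1 := by
  have h1 : (0 : ℝ) ≤ p := by positivity
  have h0 := hα.1
  have h2 : (-1 : ℝ) ≤ -2 / (p + 2 + α) := by
    rw [le_div_iff₀ (by positivity)]; linarith
  have hb := one_add_mul_self_le_rpow_one_add h2 (by linarith : 1 ≤ 1 + α)
  have e1 : 1 + (1 + α) * (-2 / (p + 2 + α)) = ((p : ℝ) - α) / (p + 2 + α) := by
    field_simp; ring
  have e2 : 1 + -2 / (p + 2 + α) = ((p : ℝ) + α) / (p + 2 + α) := by
    field_simp; ring
  rw [e1, e2] at hb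
  have hq : 0 < ((p + 2 + α) / (p + α) : ℝ) ^ (1 + α) := by positivity
  calc stepRatio α p ≤ (((p : ℝ) + α) / (p + 2 + α)) ^ (1 + α) *
        ((p + 2 + α) / (p + α)) ^ (1 + α) := mul_le_mul_of_nonneg_right hb hq.le
    _ = 1 := by
        rw [← Real.mul_rpow (by positivity) (by positivity)]
        rw [show ((p : ℝ) + α) / (p + 2 + α) * ((p + 2 + α) / (p + α)) = 1 by field_simp]
        exact Real.one_rpow _

lemma TwoStepRec.scaled_succ {α : ℝ} (hα : α ∈ Set.Ioo (0 : ℝ) 1) {ψ : ℕ → ℂ}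
    (h : TwoStepRec α ψ) (p : ℕ) :
    ψ (p + 2) * ((((p + 2 : ℕ) : ℝ) + α) ^ (1 + α) : ℝ) =
      stepRatio α p * (ψ p * (((p : ℝ) + α) ^ (1 + α) : ℝ)) := by
  have h0 := hα.1
  have hx : (0 : ℝ) < (p + 2 + α) := by positivity
  have hne : ((p : ℂ) + 2 + α) ≠ 0 := by exact_mod_cast hx.ne'
  have hs : stepRatio α p * ((p : ℝ) + α) ^ (1 + α) =
      ((p : ℝ) - α) / (p + 2 + α) * (p + 2 + α) ^ (1 + α) := by
    have : 0 < ((p : ℝ) + α) ^ (1 + α) := by positivity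
    rw [stepRatio, Real.div_rpow (by positivity) (by positivity)]
    field_simp
  have e : ψ (p + 2) = ((((p : ℝ) - α) / (p + 2 + α) : ℝ) : ℂ) * ψ p := by
    push_cast
    rw [div_mul_eq_mul_div, ← h p]
    field_simp
  have hs' := congrArg (fun t : ℝ => (t : ℂ)) hs
  simp only [Complex.ofReal_mul] at hs'
  push_cast at hs' ⊢
  rw [e]
  push_cast
  linear_combination -ψ p * hs'

lemma TwoStepRec.exists_scaled_tendsto {α : ℝ} (hα : α ∈ Set.Ioo (0 : ℝ) 1) {ψ : ℕ → ℂ}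
    (h : TwoStepRec α ψ) {s : ℕ} (hs : 1 ≤ s) :
    ∃ c, Tendsto (fun j : ℕ => ψ (2 * j + s) * ((((2 * j + s : ℕ) : ℝ) + α) ^ (1 + α) : ℝ))
      atTop (nhds c) := by
  refine exists_tendsto_of_ratio_mem_Icc (r := fun j => stepRatio α (2 * j + s))
    (fun j => stepRatio_nonneg hα (by omega)) (fun j => stepRatio_le_one hα _) fun j => ?_
  have := h.scaled_succ hα (2 * j + s)
  rwa [show 2 * j + s + 2 = 2 * (j + 1) + s by ring] at this

/-- Central sums of `ψ` telescope against this function. -/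
noncomputable def teleFun (α : ℝ) (ψ : ℕ → ℂ) (p : ℕ) : ℂ :=
  ((p : ℂ) + α) * ψ p + ((p : ℂ) + 1 + α) * ψ (p + 1)

lemma TwoStepRec.exists_bound {α : ℝ} (hα : α ∈ Set.Ioo (0 : ℝ) 1) {ψ : ℕ → ℂ}
    (h : TwoStepRec α ψ) : ∃ C, 0 ≤ C ∧ ∀ p : ℕ, 1 ≤ p →
      ‖ψ p * (((p : ℝ) + α) ^ (1 + α) : ℝ)‖ ≤ C := by
  refine ⟨max ‖ψ 1 * ((((1 : ℕ) : ℝ) + α) ^ (1 + α) : ℝ)‖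
    ‖ψ 2 * ((((2 : ℕ) : ℝ) + α) ^ (1 + α) : ℝ)‖, le_max_of_le_left (norm_nonneg _), ?_⟩
  intro p
  induction p using Nat.strong_induction_on with
  | _ p ih =>
    intro hp
    rcases Nat.lt_or_ge p 3 with h3 | h3
    · interval_cases p
      · exact le_max_left _ _
      · exact le_max_right _ _
    · obtain ⟨q, rfl⟩ : ∃ q, p = q + 2 := ⟨p - 2, by omega⟩
      rw [h.scaled_succ hα q, norm_mul]
      refine le_trans ?_ (ih q (by omega) (by omega))
      refine mul_le_of_le_one_left (norm_nonneg _) ?_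
      rw [Complex.norm_real, Real.norm_of_nonneg (stepRatio_nonneg hα (by omega))]
      exact stepRatio_le_one hα q

lemma TwoStepRec.exists_tendsto_teleFun {α : ℝ} (hα : α ∈ Set.Ioo (0 : ℝ) 1) {ψ : ℕ → ℂ}
    (h : TwoStepRec α ψ) {t : ℝ} (ht : 0 < t) {m : ℕ → ℕ}
    (hm : Tendsto (fun N => (m N : ℝ) / N) atTop (nhds t)) :
    ∃ L, Tendsto (fun N : ℕ => (((N : ℝ) ^ α : ℝ) : ℂ) * teleFun α ψ (m N)) atTop (nhds L) := by
  have h0 := hα.1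
  set b : ℕ → ℂ := fun p => ψ p * (((p : ℝ) + α) ^ (1 + α) : ℝ) with hbdef
  obtain ⟨c1, hc1⟩ := h.exists_scaled_tendsto hα (le_refl 1)
  obtain ⟨c2, hc2⟩ := h.exists_scaled_tendsto hα (by norm_num : 1 ≤ 2)
  obtain ⟨C, hC0, hC⟩ := h.exists_bound hα
  have hc1' : Tendsto (fun j => b (2 * j + 2 + 1)) atTop (nhds c1) := by
    refine (hc1.comp (tendsto_add_atTop_nat 1)).congr fun j => ?_
    simp only [Function.comp_apply, hbdef]
    rw [show 2 * (j + 1) + 1 = 2 * j + 2 + 1 by ring]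
  have hd : Tendsto (fun p => b p + b (p + 1)) atTop (nhds (c1 + c2)) :=
    tendsto_of_tendsto_odd_even (hc1.add hc2) (by rw [add_comm]; exact hc2.add hc1')
  have hNinf : Tendsto (fun N : ℕ => (N : ℝ)) atTop atTop := tendsto_natCast_atTop_atTop
  have hminf : Tendsto m atTop atTop := by
    rw [← tendsto_natCast_atTop_iff (R := ℝ)]
    refine (hm.pos_mul_atTop ht hNinf).congr' ?_
    filter_upwards [eventually_gt_atTop 0] with N hN
    field_simp
  have hpow : ∀ s : ℝ, Tendsto (fun N : ℕ => (((m N : ℝ) + s) / N) ^ (-α)) atTop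
      (nhds (t ^ (-α))) := by
    intro s
    have : Tendsto (fun N : ℕ => (((m N : ℝ) + s) / N)) atTop (nhds t) := by
      have := hm.add (hNinf.const_div_atTop s)
      simpa [add_div] using this
    exact this.rpow_const (Or.inl ht.ne')
  have hu := (Complex.continuous_ofReal.tendsto _).comp (hpow α)
  have hv := (Complex.continuous_ofReal.tendsto _).comp (hpow (1 + α))
  have hvu := hv.sub hu
  rw [sub_self] at hvu
  have hlim := ((hd.comp hminf).mul hu).add (hvu.zero_mul_isBoundedUnder_le
    (g := fun N => b (m N + 1)) ⟨C, by simpa using ⟨0, fun N _ => hC _ (by omega)⟩⟩)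
  refine ⟨_, hlim.congr' ?_⟩
  filter_upwards [eventually_gt_atTop 0] with N hN
  have hN' : (0 : ℝ) < N := by exact_mod_cast hN
  have key : ∀ q : ℝ, 0 < q → q ^ (1 + α) * (q / N) ^ (-α) = N ^ α * q := by
    intro q hq
    rw [Real.div_rpow hq.le hN'.le, Real.rpow_add hq, Real.rpow_neg hq.le, Real.rpow_neg hN'.le,
      Real.rpow_one]
    have : 0 < q ^ α := by positivity
    have : 0 < (N : ℝ) ^ α := by positivity
    field_simp
  have k1 := congrArg (fun t : ℝ => (t : ℂ)) (key ((m N : ℝ) + α) (by positivity))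
  have k2 := congrArg (fun t : ℝ => (t : ℂ)) (key ((m N : ℝ) + (1 + α)) (by positivity))
  simp only [Function.comp_apply, hbdef, teleFun]
  push_cast at k1 k2 ⊢
  simp only [add_assoc] at k1 k2 ⊢
  linear_combination ψ (m N) * k1 + ψ (m N + 1) * k2

lemma twoStepRec_phiHat_nonneg {α : ℝ} (hα : 0 < α) :
    TwoStepRec α fun p => phiHat α (p : ℤ) := by
  intro p
  have := phiHat_recurrence hα (p : ℤ)
  push_cast at this ⊢
  exact this

lemma twoStepRec_phiHat_nonpos {α : ℝ} (hα : 0 < α) :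
    TwoStepRec α fun p => phiHat α (-(p : ℤ)) := by
  intro p
  have := phiHat_recurrence hα (-(p : ℤ) - 2)
  rw [show -(p : ℤ) - 2 + 2 = -p by ring] at this
  push_cast at this ⊢
  rw [show -((p : ℤ) + 2) = -p - 2 by ring]
  linear_combination this

lemma TwoStepRec.exists_norm_le {α : ℝ} (hα : α ∈ Set.Ioo (0 : ℝ) 1) {ψ : ℕ → ℂ}
    (h : TwoStepRec α ψ) : ∃ C, 0 ≤ C ∧ ∀ p : ℕ, 1 ≤ p → ‖ψ p‖ ≤ C * (p : ℝ) ^ (-(1 + α)) := by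
  have h0 := hα.1
  obtain ⟨C, hC0, hC⟩ := h.exists_bound hα
  refine ⟨C, hC0, fun p hp => ?_⟩
  have hp' : (0 : ℝ) < p := by exact_mod_cast hp
  have := hC p hp
  rw [norm_mul, Complex.norm_real, Real.norm_of_nonneg (by positivity)] at this
  rw [Real.rpow_neg hp'.le, ← div_eq_mul_inv, le_div_iff₀ (by positivity)]
  refine le_trans (mul_le_mul_of_nonneg_left ?_ (norm_nonneg _)) this
  exact Real.rpow_le_rpow hp'.le (by linarith) (by linarith)

lemma exists_norm_phiHat_le {α : ℝ} (hα : α ∈ Set.Ioo (0 : ℝ) 1) :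
    ∃ C, 0 ≤ C ∧ ∀ m : ℤ, m ≠ 0 → ‖phiHat α m‖ ≤ C * |(m : ℝ)| ^ (-(1 + α)) := by
  obtain ⟨C1, h1, hC1⟩ := (twoStepRec_phiHat_nonneg hα.1).exists_norm_le hα
  obtain ⟨C2, h2, hC2⟩ := (twoStepRec_phiHat_nonpos hα.1).exists_norm_le hα
  refine ⟨max C1 C2, le_max_of_le_left h1, fun m hm => ?_⟩
  obtain ⟨p, rfl | rfl⟩ := Int.eq_nat_or_neg m
  · simp only [Int.cast_natCast, Nat.abs_cast]
    exact (hC1 p (by omega)).trans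
      (mul_le_mul_of_nonneg_right (le_max_left _ _) (by positivity))
  · simp only [Int.cast_neg, abs_neg, Int.cast_natCast, Nat.abs_cast]
    exact (hC2 p (by omega)).trans
      (mul_le_mul_of_nonneg_right (le_max_right _ _) (by positivity))

lemma summable_norm_phiHat {α : ℝ} (hα : α ∈ Set.Ioo (0 : ℝ) 1) :
    Summable fun m : ℤ => ‖phiHat α m‖ := by
  have hs : Summable fun p : ℕ => (p : ℝ) ^ (-(1 + α)) :=
    Real.summable_nat_rpow.2 (by linarith [hα.1])
  obtain ⟨C1, h1, hC1⟩ := (twoStepRec_phiHat_nonneg hα.1).exists_norm_le hα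
  obtain ⟨C2, h2, hC2⟩ := (twoStepRec_phiHat_nonpos hα.1).exists_norm_le hα
  refine Summable.of_nat_of_neg ?_ ?_
  · refine (hs.mul_left C1).of_norm_bounded_eventually_nat ?_
    filter_upwards [eventually_ge_atTop 1] with p hp
    rw [norm_norm]; exact hC1 p hp
  · refine (hs.mul_left C2).of_norm_bounded_eventually_nat ?_
    filter_upwards [eventually_ge_atTop 1] with p hp
    rw [norm_norm]; exact hC2 p hp

/-- `phiHat α` is, up to the factor `2 * α`, the difference sequence of this function. -/
noncomputable def phiTele (α : ℝ) (m : ℤ) : ℂ :=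
  ((m : ℂ) + α) * phiHat α m + ((m : ℂ) + 1 + α) * phiHat α (m + 1)

lemma phiTele_sub {α : ℝ} (hα : 0 < α) (m : ℤ) :
    phiTele α m - phiTele α (m + 1) = 2 * α * phiHat α m := by
  have := phiHat_recurrence hα m
  rw [phiTele, phiTele, show m + 1 + 1 = m + 2 by ring]
  push_cast
  linear_combination -this

lemma sum_Ioc_phiHat {α : ℝ} (hα : 0 < α) (k A : ℤ) {B : ℤ} (hAB : A ≤ B) :
    2 * α * ∑ l ∈ Finset.Ioc A B, phiHat α (k - l) = phiTele α (k - B) - phiTele α (k - A) := by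
  induction B, hAB using Int.leInduction with
  | base => simp
  | succ B hB ih =>
    have hset : Finset.Ioc A (B + 1) = insert (B + 1) (Finset.Ioc A B) := by
      ext l; simp only [Finset.mem_Ioc, Finset.mem_insert]; omega
    rw [hset, Finset.sum_insert (by simp), mul_add, ih, ← phiTele_sub hα,
      show k - (B + 1) + 1 = k - B by ring]
    ring

lemma tendsto_int_floor_div (s : ℝ) :
    Tendsto (fun N : ℕ => ((⌊(N : ℝ) * s⌋ : ℤ) : ℝ) / N) atTop (nhds s) := by
  have hN : Tendsto (fun N : ℕ => (N : ℝ)) atTop atTop := tendsto_natCast_atTop_atTop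
  have hlow : Tendsto (fun N : ℕ => s - 1 / (N : ℝ)) atTop (nhds s) := by
    simpa using tendsto_const_nhds.sub (hN.const_div_atTop (1 : ℝ))
  refine tendsto_of_tendsto_of_tendsto_of_le_of_le' hlow tendsto_const_nhds ?_ ?_
  · filter_upwards [eventually_gt_atTop 0] with N hN
    have hN' : (0 : ℝ) < N := by exact_mod_cast hN
    rw [le_div_iff₀ hN', sub_mul, div_mul_cancel₀ _ hN'.ne']
    linarith [Int.lt_floor_add_one ((N : ℝ) * s)]
  · filter_upwards [eventually_gt_atTop 0] with N hN
    have hN' : (0 : ℝ) < N := by exact_mod_cast hN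
    rw [div_le_iff₀ hN']
    linarith [Int.floor_le ((N : ℝ) * s)]

lemma exists_tendsto_phiTele_of_pos {α : ℝ} (hα : α ∈ Set.Ioo (0 : ℝ) 1) {t : ℝ} (ht : 0 < t)
    {m : ℕ → ℤ} (hm : Tendsto (fun N => (m N : ℝ) / N) atTop (nhds t)) :
    ∃ L, Tendsto (fun N : ℕ => (((N : ℝ) ^ α : ℝ) : ℂ) * phiTele α (m N)) atTop (nhds L) := by
  have hpos : ∀ᶠ N : ℕ in atTop, ((m N).toNat : ℤ) = m N := by
    filter_upwards [hm.eventually (lt_mem_nhds ht)] with N hN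
    have : (0 : ℝ) < m N := by
      by_contra hcon
      exact absurd hN (not_lt.2 (div_nonpos_of_nonpos_of_nonneg (not_lt.1 hcon) (by positivity)))
    have : 0 < m N := by exact_mod_cast this
    omega
  obtain ⟨L, hL⟩ := (twoStepRec_phiHat_nonneg hα.1).exists_tendsto_teleFun hα ht
    (m := fun N => (m N).toNat) (hm.congr' (by
      filter_upwards [hpos] with N hN
      rw [← Int.cast_natCast (R := ℝ) (m N).toNat, hN]))
  refine ⟨L, hL.congr' ?_⟩
  filter_upwards [hpos] with N hN
  rw [teleFun, phiTele]
  push_cast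
  rw [← Int.cast_natCast (R := ℂ) (m N).toNat, hN]

lemma phiTele_neg {α : ℝ} (hα : 0 < α) (p : ℕ) :
    phiTele α (1 - p) = -teleFun α (fun q => phiHat α (-(q : ℤ))) p := by
  have h1 := phiHat_recurrence hα (-(p : ℤ) - 1)
  have h2 := phiHat_recurrence hα (-(p : ℤ))
  rw [show -(p : ℤ) - 1 + 2 = 1 - p by ring] at h1
  rw [show -(p : ℤ) + 2 = 1 - p + 1 by ring] at h2
  rw [phiTele, teleFun]
  push_cast at h1 h2 ⊢
  rw [show -((p : ℤ) + 1) = -(p : ℤ) - 1 by ring]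
  linear_combination h1 + h2

lemma exists_tendsto_phiTele {α : ℝ} (hα : α ∈ Set.Ioo (0 : ℝ) 1) {t : ℝ} (ht : t ≠ 0)
    {m : ℕ → ℤ} (hm : Tendsto (fun N => (m N : ℝ) / N) atTop (nhds t)) :
    ∃ L, Tendsto (fun N : ℕ => (((N : ℝ) ^ α : ℝ) : ℂ) * phiTele α (m N)) atTop (nhds L) := by
  rcases ht.lt_or_gt with ht | ht
  · have hneg : ∀ᶠ N : ℕ in atTop, ((1 - m N).toNat : ℤ) = 1 - m N := by
      filter_upwards [hm.eventually (gt_mem_nhds ht)] with N hN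
      have : (m N : ℝ) < 0 := by
        by_contra hcon
        exact absurd hN (not_lt.2 (div_nonneg (not_lt.1 hcon) (by positivity)))
      have : m N < 0 := by exact_mod_cast this
      omega
    have hm' : Tendsto (fun N : ℕ => ((1 - m N).toNat : ℝ) / N) atTop (nhds (-t)) := by
      have := ((tendsto_natCast_atTop_atTop (R := ℝ)).const_div_atTop 1).sub hm
      rw [zero_sub] at this
      refine this.congr' ?_
      filter_upwards [hneg] with N hN
      rw [← Int.cast_natCast (R := ℝ) (1 - m N).toNat, hN]
      push_cast
      ring
    obtain ⟨L, hL⟩ := (twoStepRec_phiHat_nonpos hα.1).exists_tendsto_teleFun hα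
      (neg_pos.2 ht) hm'
    refine ⟨-L, hL.neg.congr' ?_⟩
    filter_upwards [hneg] with N hN
    have e := phiTele_neg hα.1 (1 - m N).toNat
    rw [hN, sub_sub_cancel] at e
    rw [e, mul_neg]
  · exact exists_tendsto_phiTele_of_pos hα ht hm

/-- The weights of the discretized operator. -/
noncomputable def weight (α x : ℝ) (N : ℕ) (l : ℤ) : ℂ :=
  (((N : ℝ) ^ α : ℝ) : ℂ) * phiHat α (⌊(N : ℝ) * x⌋ - l)

/-- The lattice points of `(s, t]` at scale `N`. -/
noncomputable def lattice (s t : ℝ) (N : ℕ) : Finset ℤ :=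
  Finset.Ioc ⌊(N : ℝ) * s⌋ ⌊(N : ℝ) * t⌋

lemma exists_tendsto_sum_weight {α : ℝ} (hα : α ∈ Set.Ioo (0 : ℝ) 1) {x s t : ℝ} (hst : s ≤ t)
    (hs : s ≠ x) (ht : t ≠ x) :
    ∃ L, Tendsto (fun N => ∑ l ∈ lattice s t N, weight α x N l) atTop (nhds L) := by
  have hlim : ∀ u, u ≠ x → ∃ L, Tendsto (fun N : ℕ => (((N : ℝ) ^ α : ℝ) : ℂ) *
      phiTele α (⌊(N : ℝ) * x⌋ - ⌊(N : ℝ) * u⌋)) atTop (nhds L) := fun u hu =>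
    exists_tendsto_phiTele hα (t := x - u) (sub_ne_zero.2 hu.symm) (by
      refine ((tendsto_int_floor_div x).sub (tendsto_int_floor_div u)).congr fun N => ?_
      push_cast; ring)
  obtain ⟨L1, h1⟩ := hlim t ht
  obtain ⟨L2, h2⟩ := hlim s hs
  refine ⟨_, ((h1.sub h2).mul_const (1 / (2 * α : ℂ))).congr fun N => ?_⟩
  have hα0 : (α : ℂ) ≠ 0 := by exact_mod_cast hα.1.ne'
  have := sum_Ioc_phiHat hα.1 ⌊(N : ℝ) * x⌋ ⌊(N : ℝ) * s⌋ (B := ⌊(N : ℝ) * t⌋)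
    (Int.floor_le_floor (mul_le_mul_of_nonneg_left hst (by positivity)))
  simp only [weight, lattice]
  rw [← Finset.mul_sum, ← mul_sub, ← this]
  field_simp

lemma exists_tendsto_of_approx {a : ℕ → ℂ}
    (h : ∀ ε > 0, ∃ b : ℕ → ℂ, (∃ L, Tendsto b atTop (nhds L)) ∧ ∀ᶠ N in atTop, ‖a N - b N‖ ≤ ε) :
    ∃ L, Tendsto a atTop (nhds L) := by
  refine cauchySeq_tendsto_of_complete (Metric.cauchySeq_iff'.2 fun ε hε => ?_)
  obtain ⟨b, ⟨L, hL⟩, hb⟩ := h (ε / 5) (by positivity)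
  have hev := hb.and ((Metric.tendsto_nhds.1 hL) (ε / 5) (by positivity))
  obtain ⟨M, hM⟩ := eventually_atTop.1 hev
  refine ⟨M, fun N hN => ?_⟩
  have h1 := hM N hN
  have h2 := hM M le_rfl
  simp only [← dist_eq_norm] at h1 h2
  have t1 := dist_triangle (a N) (b N) (a M)
  have t2 := dist_triangle (b N) L (a M)
  have t3 := dist_triangle L (b M) (a M)
  rw [dist_comm (b M) (a M), dist_comm L (b M)] at t3
  linarith [h1.1, h1.2, h2.1, h2.2]

lemma mem_lattice {s t : ℝ} {N : ℕ} {l : ℤ} :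
    l ∈ lattice s t N ↔ (N : ℝ) * s < l ∧ (l : ℝ) ≤ N * t := by
  rw [lattice, Finset.mem_Ioc, Int.floor_lt, Int.le_floor]

lemma sum_lattice_add {E : Type*} [AddCommMonoid E] (F : ℤ → E) {s t u : ℝ} (hst : s ≤ t)
    (htu : t ≤ u) (N : ℕ) :
    ∑ l ∈ lattice s t N, F l + ∑ l ∈ lattice t u N, F l = ∑ l ∈ lattice s u N, F l := by
  have h1 : ⌊(N : ℝ) * s⌋ ≤ ⌊(N : ℝ) * t⌋ :=
    Int.floor_le_floor (mul_le_mul_of_nonneg_left hst (by positivity))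
  have h2 : ⌊(N : ℝ) * t⌋ ≤ ⌊(N : ℝ) * u⌋ :=
    Int.floor_le_floor (mul_le_mul_of_nonneg_left htu (by positivity))
  rw [← Finset.sum_union]
  · congr 1
    ext l
    simp only [lattice, Finset.mem_union, Finset.mem_Ioc]
    omega
  · rw [Finset.disjoint_left]
    intro l
    simp only [lattice, Finset.mem_Ioc]
    omega

lemma eventually_norm_weight_le {α : ℝ} (hα : α ∈ Set.Ioo (0 : ℝ) 1) (x : ℝ) {δ : ℝ}
    (hδ : 0 < δ) : ∃ C, 0 ≤ C ∧ ∀ᶠ N : ℕ in atTop, ∀ l : ℤ, δ * N ≤ |(N : ℝ) * x - l| →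
      ‖weight α x N l‖ ≤ C / N := by
  obtain ⟨C, hC0, hC⟩ := exists_norm_phiHat_le hα
  refine ⟨C * (δ / 2) ^ (-(1 + α)), by positivity, ?_⟩
  have hN := (tendsto_natCast_atTop_atTop (R := ℝ)).eventually_ge_atTop (2 / δ)
  filter_upwards [hN, eventually_gt_atTop 0] with N hN hN0 l hl
  have hN' : (0 : ℝ) < N := by exact_mod_cast hN0
  rw [div_le_iff₀ hδ] at hN
  have hfl : |(N : ℝ) * x - ⌊(N : ℝ) * x⌋| ≤ 1 := by
    rw [abs_le]
    constructor <;> linarith [Int.floor_le ((N : ℝ) * x), Int.lt_floor_add_one ((N : ℝ) * x)]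
  have hm : δ / 2 * N ≤ |((⌊(N : ℝ) * x⌋ - l : ℤ) : ℝ)| := by
    push_cast
    have := abs_add_le ((N : ℝ) * x - ⌊(N : ℝ) * x⌋) (⌊(N : ℝ) * x⌋ - l)
    rw [sub_add_sub_cancel] at this
    linarith
  have hpos : 0 < δ / 2 * N := by positivity
  have hne : ⌊(N : ℝ) * x⌋ - l ≠ 0 := by
    intro h0
    rw [h0] at hm
    simp only [Int.cast_zero, abs_zero] at hm
    linarith
  rw [weight, norm_mul, Complex.norm_real, Real.norm_of_nonneg (by positivity)]
  calc (N : ℝ) ^ α * ‖phiHat α (⌊(N : ℝ) * x⌋ - l)‖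
      ≤ N ^ α * (C * (δ / 2 * N) ^ (-(1 + α))) := by
        refine mul_le_mul_of_nonneg_left ((hC _ hne).trans ?_) (by positivity)
        refine mul_le_mul_of_nonneg_left ?_ hC0
        exact Real.rpow_le_rpow_of_nonpos hpos hm (by linarith [hα.1])
    _ = C * (δ / 2) ^ (-(1 + α)) / N := by
        rw [Real.mul_rpow (by positivity) hN'.le, neg_add, Real.rpow_add hN', Real.rpow_neg hN'.le α,
          Real.rpow_neg_one]
        have : 0 < (N : ℝ) ^ α := by positivity
        field_simp

lemma card_lattice_le {s t : ℝ} (hst : s ≤ t) (N : ℕ) :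
    ((lattice s t N).card : ℝ) ≤ N * (t - s) + 1 := by
  have h1 : ⌊(N : ℝ) * s⌋ ≤ ⌊(N : ℝ) * t⌋ :=
    Int.floor_le_floor (mul_le_mul_of_nonneg_left hst (by positivity))
  have h2 : ((lattice s t N).card : ℤ) = ⌊(N : ℝ) * t⌋ - ⌊(N : ℝ) * s⌋ := by
    rw [lattice, Int.card_Ioc]; omega
  have h3 : ((lattice s t N).card : ℝ) = (⌊(N : ℝ) * t⌋ : ℝ) - ⌊(N : ℝ) * s⌋ := by exact_mod_cast h2
  rw [h3]
  linarith [Int.floor_le ((N : ℝ) * t), Int.lt_floor_add_one ((N : ℝ) * s)]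

lemma eventually_sum_norm_weight_le {α : ℝ} (hα : α ∈ Set.Ioo (0 : ℝ) 1) {x p q : ℝ}
    (hpq : p ≤ q) (hx : x ∉ Set.Icc p q) :
    ∃ M, 0 ≤ M ∧ ∀ᶠ N : ℕ in atTop, ∑ l ∈ lattice p q N, ‖weight α x N l‖ ≤ M := by
  obtain ⟨δ, hδ, hd⟩ : ∃ δ > 0, ∀ s ∈ Set.Icc p q, δ ≤ |x - s| := by
    rcases lt_or_ge x p with h | h
    · refine ⟨p - x, by linarith, fun s hs => ?_⟩
      rw [abs_sub_comm]
      exact le_trans (by linarith [hs.1]) (le_abs_self _)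
    · have h' : q < x := by by_contra hc; exact hx ⟨h, not_lt.1 hc⟩
      exact ⟨x - q, by linarith, fun s hs => le_trans (by linarith [hs.2]) (le_abs_self _)⟩
  obtain ⟨C, hC0, hC⟩ := eventually_norm_weight_le hα x hδ
  refine ⟨C * (q - p + 1), mul_nonneg hC0 (by linarith), ?_⟩
  filter_upwards [hC, eventually_ge_atTop 1] with N hN hN1
  have hN' : (1 : ℝ) ≤ N := by exact_mod_cast hN1
  calc ∑ l ∈ lattice p q N, ‖weight α x N l‖ ≤ ∑ _l ∈ lattice p q N, C / N := by
        refine Finset.sum_le_sum fun l hl => hN l ?_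
        rw [mem_lattice] at hl
        have := hd (l / N) ⟨(le_div_iff₀ (by linarith)).2 (by linarith),
          (div_le_iff₀ (by linarith)).2 (by linarith)⟩
        calc δ * N ≤ |x - l / N| * N := mul_le_mul_of_nonneg_right this (by linarith)
          _ = |x - l / N| * |(N : ℝ)| := by rw [Nat.abs_cast]
          _ = |(N : ℝ) * x - l| := by
            rw [← abs_mul]; congr 1; field_simp
    _ ≤ (N * (q - p) + 1) * (C / N) := by
        rw [Finset.sum_const, nsmul_eq_mul]
        exact mul_le_mul_of_nonneg_right (card_lattice_le hpq N) (by positivity)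
    _ ≤ C * (q - p + 1) := by
        rw [← mul_div_assoc, div_le_iff₀ (by linarith)]
        nlinarith [mul_nonneg hC0 (by linarith : 0 ≤ (N : ℝ) - 1)]

lemma exists_step_approx {α : ℝ} (hα : α ∈ Set.Ioo (0 : ℝ) 1) {x p d K : ℝ} (hd : 0 ≤ d)
    {h : ℝ → ℝ} (j : ℕ) (hx : x ∉ Set.Icc p (p + j * d))
    (hh : ∀ z ∈ Set.Icc p (p + j * d), ∀ z' ∈ Set.Icc p (p + j * d), |h z - h z'| ≤ K * |z - z'|)
    (hK : 0 ≤ K) :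
    ∃ b : ℕ → ℂ, (∃ L, Tendsto b atTop (nhds L)) ∧ ∀ᶠ N : ℕ in atTop,
      ‖∑ l ∈ lattice p (p + j * d) N, weight α x N l * h (l / N) - b N‖ ≤
        K * d * ∑ l ∈ lattice p (p + j * d) N, ‖weight α x N l‖ := by
  induction j with
  | zero => exact ⟨0, ⟨0, tendsto_const_nhds⟩, Eventually.of_forall fun N => by simp [lattice]⟩
  | succ j ih =>
    have hjd : 0 ≤ j * d := by positivity
    set q := p + j * d with hq
    have hq' : p + ((j + 1 : ℕ) : ℝ) * d = q + d := by rw [hq]; push_cast; ring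
    rw [hq'] at hx hh ⊢
    have hsub : Set.Icc p q ⊆ Set.Icc p (q + d) := Set.Icc_subset_Icc_right (by linarith)
    obtain ⟨b, ⟨L, hL⟩, hb⟩ := ih (fun hc => hx (hsub hc))
      (fun z hz z' hz' => hh z (hsub hz) z' (hsub hz'))
    obtain ⟨L', hL'⟩ := exists_tendsto_sum_weight hα (x := x) (s := q) (t := q + d) (by linarith)
      (fun hc => hx ⟨by linarith, by linarith⟩) (fun hc => hx ⟨by linarith, by linarith⟩)
    refine ⟨_, ⟨_, hL.add (hL'.mul_const (h q : ℂ))⟩, ?_⟩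
    filter_upwards [hb, eventually_gt_atTop 0] with N hN hN0
    have hN' : (0 : ℝ) < N := by exact_mod_cast hN0
    rw [← sum_lattice_add _ (by linarith : p ≤ q) (by linarith : q ≤ q + d),
      ← sum_lattice_add _ (by linarith : p ≤ q) (by linarith : q ≤ q + d), add_sub_add_comm,
      Finset.sum_mul, ← Finset.sum_sub_distrib, mul_add]
    refine (norm_add_le _ _).trans (add_le_add hN ?_)
    rw [Finset.mul_sum]
    refine (norm_sum_le _ _).trans (Finset.sum_le_sum fun l hl => ?_)
    rw [mem_lattice] at hl
    have h1 : q ≤ l / N := (le_div_iff₀ hN').2 (by linarith)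
    have h2 : (l : ℝ) / N ≤ q + d := (div_le_iff₀ hN').2 (by linarith)
    rw [← mul_sub, norm_mul, mul_comm, ← Complex.ofReal_sub, Complex.norm_real, Real.norm_eq_abs]
    refine mul_le_mul_of_nonneg_right ?_ (norm_nonneg _)
    refine (hh _ ⟨by linarith, h2⟩ q ⟨by linarith, by linarith⟩).trans ?_
    refine mul_le_mul_of_nonneg_left ?_ hK
    rw [abs_of_nonneg (by linarith)]
    linarith

lemma exists_tendsto_sum_off_diag {α : ℝ} (hα : α ∈ Set.Ioo (0 : ℝ) 1) {x p q K : ℝ}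
    (hpq : p ≤ q) (hx : x ∉ Set.Icc p q) {h : ℝ → ℝ} (hK : 0 ≤ K)
    (hh : ∀ z ∈ Set.Icc p q, ∀ z' ∈ Set.Icc p q, |h z - h z'| ≤ K * |z - z'|) :
    ∃ L, Tendsto (fun N : ℕ => ∑ l ∈ lattice p q N, weight α x N l * h (l / N))
      atTop (nhds L) := by
  obtain ⟨M, hM0, hM⟩ := eventually_sum_norm_weight_le hα hpq hx
  refine exists_tendsto_of_approx fun ε hε => ?_
  obtain ⟨J, hJ⟩ := exists_nat_gt (K * (q - p) * M / ε)
  have hJ0 : (0 : ℝ) < J := lt_of_le_of_lt (by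
    have : 0 ≤ q - p := by linarith
    positivity) hJ
  have he : p + J * ((q - p) / J) = q := by field_simp; ring
  obtain ⟨b, hb, hb'⟩ := exists_step_approx hα (x := x) (p := p) (K := K) (h := h)
    (d := (q - p) / J) (by have : 0 ≤ q - p := by linarith
                           positivity) J (by rwa [he]) (by rwa [he]) hK
  rw [he] at hb'
  refine ⟨b, hb, ?_⟩
  filter_upwards [hb', hM] with N h1 h2
  refine h1.trans ?_
  rw [div_lt_iff₀ hε] at hJ
  have : 0 ≤ K * ((q - p) / J) := by
    have : 0 ≤ q - p := by linarith
    positivity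
  refine (mul_le_mul_of_nonneg_left h2 this).trans ?_
  rw [mul_div_assoc', div_mul_eq_mul_div, div_le_iff₀ hJ0]
  linarith

lemma mul_rpow_neg_le_sub {γ t h : ℝ} (hγ : γ ∈ Set.Ico (0 : ℝ) 1) (ht : 0 < t) (hht : h ≤ t) :
    h * ((1 - γ) * t ^ (-γ)) ≤ t ^ (1 - γ) - (t - h) ^ (1 - γ) := by
  have h1 : -1 ≤ -h / t := by rw [le_div_iff₀ ht]; linarith
  have hb := rpow_one_add_le_one_add_mul_self h1 (by linarith [hγ.2] : 0 ≤ 1 - γ)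
    (by linarith [hγ.1])
  have h2 : 0 < t ^ (1 - γ) := by positivity
  have h3 := mul_le_mul_of_nonneg_left hb h2.le
  rw [← Real.mul_rpow ht.le (by linarith)] at h3
  have e1 : t * (1 + -h / t) = t - h := by field_simp; ring
  have e2 : t ^ (1 - γ) = t * t ^ (-γ) := by
    rw [sub_eq_add_neg, Real.rpow_add ht, Real.rpow_one]
  have e3 : t ^ (1 - γ) * (1 + (1 - γ) * (-h / t)) = t ^ (1 - γ) - h * ((1 - γ) * t ^ (-γ)) := by
    rw [e2]; field_simp; ring
  rw [e1, e3] at h3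
  linarith

lemma sum_Icc_rpow_neg_le {α : ℝ} (hα : α ∈ Set.Ioo (0 : ℝ) 1) (M : ℕ) :
    ∑ m ∈ Finset.Icc (-(M : ℤ)) M, |(m : ℝ)| ^ (-α) ≤ 2 * (M : ℝ) ^ (1 - α) / (1 - α) := by
  have h1 : 0 < 1 - α := by linarith [hα.2]
  induction M with
  | zero => simp [Real.zero_rpow (by linarith [hα.1] : -α ≠ 0), Real.zero_rpow h1.ne']
  | succ M ih =>
    have hset : Finset.Icc (-((M + 1 : ℕ) : ℤ)) ((M + 1 : ℕ) : ℤ) =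
        insert (-(M + 1 : ℤ)) (insert (M + 1 : ℤ) (Finset.Icc (-(M : ℤ)) M)) := by
      ext m; simp only [Finset.mem_insert, Finset.mem_Icc]; omega
    rw [hset, Finset.sum_insert (by simp only [Finset.mem_insert, Finset.mem_Icc]; omega),
      Finset.sum_insert (by simp)]
    have key := mul_rpow_neg_le_sub (γ := α) (t := M + 1) (h := 1) ⟨hα.1.le, hα.2⟩
      (by positivity) (by linarith [(Nat.cast_nonneg M : (0 : ℝ) ≤ M)])
    rw [add_sub_cancel_right, one_mul] at key
    rw [le_div_iff₀ h1] at ih ⊢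
    push_cast
    rw [abs_neg, abs_of_nonneg (by positivity : (0 : ℝ) ≤ M + 1)]
    nlinarith

lemma exists_near_diag_bound {α : ℝ} (hα : α ∈ Set.Ioo (0 : ℝ) 1) (x : ℝ) :
    ∃ C, 0 ≤ C ∧ ∀ δ > 0, ∀ᶠ N : ℕ in atTop,
      ∑ l ∈ lattice (x - δ) (x + δ) N, ‖weight α x N l‖ * |(l : ℝ) / N - x| ≤ C * δ ^ (1 - α) := by
  obtain ⟨C, hC0, hC⟩ := exists_norm_phiHat_le hα
  have h1 : 0 < 1 - α := by linarith [hα.2]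
  have hsum := summable_norm_phiHat hα
  set B := ∑' m : ℤ, ‖phiHat α m‖ with hB
  refine ⟨C * (2 * 2 ^ (1 - α) / (1 - α)) + 1, by positivity, fun δ hδ => ?_⟩
  have hNtop := tendsto_natCast_atTop_atTop (R := ℝ)
  have hB0 : Tendsto (fun N : ℕ => (N : ℝ) ^ (-(1 - α)) * B) atTop (nhds 0) := by
    simpa using ((tendsto_rpow_neg_atTop h1).comp hNtop).mul_const B
  filter_upwards [hB0.eventually (gt_mem_nhds (by positivity : 0 < δ ^ (1 - α))),
    hNtop.eventually_ge_atTop (1 / δ), eventually_gt_atTop 0] with N hN1 hN2 hN0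
  have hN' : (0 : ℝ) < N := by exact_mod_cast hN0
  rw [div_le_iff₀ hδ] at hN2
  set k := ⌊(N : ℝ) * x⌋ with hk
  have hkl := Int.floor_le ((N : ℝ) * x)
  have hku := Int.lt_floor_add_one ((N : ℝ) * x)
  rw [← hk] at hkl hku
  set M := ⌊2 * δ * (N : ℝ)⌋₊ with hM
  have hterm : ∀ l : ℤ, ‖weight α x N l‖ * |(l : ℝ) / N - x| ≤
      N ^ (-(1 - α)) * (C * |((k - l : ℤ) : ℝ)| ^ (-α) + ‖phiHat α (k - l)‖) := by
    intro l
    have hd : |(l : ℝ) / N - x| ≤ (|((k - l : ℤ) : ℝ)| + 1) / N := by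
      rw [le_div_iff₀ hN', ← abs_of_pos hN', ← abs_mul, sub_mul, abs_of_pos hN',
        div_mul_cancel₀ _ hN'.ne']
      push_cast
      have := abs_add_le ((l : ℝ) - k) (k - x * N)
      rw [sub_add_sub_cancel, abs_sub_comm (l : ℝ) k] at this
      have h2 : |(k : ℝ) - x * N| ≤ 1 := by rw [abs_le]; constructor <;> linarith
      linarith
    have hphi : ‖phiHat α (k - l)‖ * |((k - l : ℤ) : ℝ)| ≤ C * |((k - l : ℤ) : ℝ)| ^ (-α) := by
      rcases eq_or_ne (k - l) 0 with h0 | h0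
      · rw [h0]; simp only [Int.cast_zero, abs_zero, mul_zero]; positivity
      · have hpos : 0 < |((k - l : ℤ) : ℝ)| := abs_pos.2 (by exact_mod_cast h0)
        refine (mul_le_mul_of_nonneg_right (hC _ h0) hpos.le).trans (le_of_eq ?_)
        rw [mul_assoc, ← Real.rpow_add_one hpos.ne']
        congr 2; ring
    rw [weight, norm_mul, Complex.norm_real, Real.norm_of_nonneg (by positivity), ← hk]
    have e : (N : ℝ) ^ (-(1 - α)) = N ^ α / N := by
      rw [neg_sub, Real.rpow_sub hN', Real.rpow_one]
    rw [e]
    calc (N : ℝ) ^ α * ‖phiHat α (k - l)‖ * |(l : ℝ) / N - x|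
        ≤ (N : ℝ) ^ α * ‖phiHat α (k - l)‖ * ((|((k - l : ℤ) : ℝ)| + 1) / N) :=
          mul_le_mul_of_nonneg_left hd (by positivity)
      _ = (N : ℝ) ^ α / N * (‖phiHat α (k - l)‖ * |((k - l : ℤ) : ℝ)| + ‖phiHat α (k - l)‖) := by
          ring
      _ ≤ _ := by gcongr
  have hinj : Set.InjOn (fun l : ℤ => k - l) (lattice (x - δ) (x + δ) N) := by
    intro a _ b _ hab; simpa using hab
  have hs1 : ∑ l ∈ lattice (x - δ) (x + δ) N, |((k - l : ℤ) : ℝ)| ^ (-α) ≤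
      2 * (M : ℝ) ^ (1 - α) / (1 - α) := by
    refine le_trans ?_ (sum_Icc_rpow_neg_le hα M)
    rw [← Finset.sum_image (f := fun m : ℤ => |(m : ℝ)| ^ (-α)) hinj]
    refine Finset.sum_le_sum_of_subset_of_nonneg ?_ fun _ _ _ => by positivity
    intro m hm
    obtain ⟨l, hl, rfl⟩ := Finset.mem_image.1 hm
    rw [mem_lattice] at hl
    have hMl : ∀ z : ℤ, (z : ℝ) ≤ 2 * δ * N → z ≤ M := by
      intro z hz
      rw [hM, Int.natCast_floor_eq_floor (by positivity), Int.le_floor]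
      exact hz
    have ha := hMl (k - l) (by push_cast; linarith)
    have hb := hMl (l - k) (by push_cast; linarith)
    rw [Finset.mem_Icc]
    omega
  have hs2 : ∑ l ∈ lattice (x - δ) (x + δ) N, ‖phiHat α (k - l)‖ ≤ B := by
    rw [← Finset.sum_image (f := fun m : ℤ => ‖phiHat α m‖) hinj]
    exact hsum.sum_le_tsum _ fun _ _ => norm_nonneg _
  have hM' : (M : ℝ) ^ (1 - α) ≤ 2 ^ (1 - α) * δ ^ (1 - α) * N ^ (1 - α) := by
    rw [← Real.mul_rpow (by norm_num) hδ.le, ← Real.mul_rpow (by positivity) hN'.le]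
    exact Real.rpow_le_rpow (by positivity) (Nat.floor_le (by positivity)) h1.le
  calc _ ≤ ∑ l ∈ lattice (x - δ) (x + δ) N,
        N ^ (-(1 - α)) * (C * |((k - l : ℤ) : ℝ)| ^ (-α) + ‖phiHat α (k - l)‖) :=
        Finset.sum_le_sum fun l _ => hterm l
    _ = N ^ (-(1 - α)) * (C * ∑ l ∈ lattice (x - δ) (x + δ) N, |((k - l : ℤ) : ℝ)| ^ (-α)) +
        N ^ (-(1 - α)) * ∑ l ∈ lattice (x - δ) (x + δ) N, ‖phiHat α (k - l)‖ := by
        rw [← Finset.mul_sum, Finset.sum_add_distrib, Finset.mul_sum, mul_add]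
    _ ≤ N ^ (-(1 - α)) * (C * (2 * (2 ^ (1 - α) * δ ^ (1 - α) * N ^ (1 - α)) / (1 - α))) +
        δ ^ (1 - α) := by
        refine add_le_add ?_ ((mul_le_mul_of_nonneg_left hs2 (by positivity)).trans hN1.le)
        gcongr
        exact hs1.trans (by gcongr)
    _ = _ := by
        rw [Real.rpow_neg hN'.le]
        have : 0 < (N : ℝ) ^ (1 - α) := by positivity
        field_simp

lemma exists_tendsto_sum_lipschitz {α : ℝ} (hα : α ∈ Set.Ioo (0 : ℝ) 1) {x p q K : ℝ}
    (hp : p < x) (hq : x < q) {h : ℝ → ℝ} (hK : 0 ≤ K)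
    (hh : ∀ z ∈ Set.Icc p q, ∀ z' ∈ Set.Icc p q, |h z - h z'| ≤ K * |z - z'|) :
    ∃ L, Tendsto (fun N : ℕ => ∑ l ∈ lattice p q N, weight α x N l * h (l / N))
      atTop (nhds L) := by
  obtain ⟨C, hC0, hC⟩ := exists_near_diag_bound hα x
  refine exists_tendsto_of_approx fun ε hε => ?_
  have h1 : 0 < 1 - α := by linarith [hα.2]
  have hlim : Tendsto (fun δ : ℝ => K * (C * δ ^ (1 - α))) (nhdsWithin 0 (Set.Ioi 0)) (nhds 0) := by
    have : Tendsto (fun δ : ℝ => K * (C * δ ^ (1 - α))) (nhds 0) (nhds (K * (C * 0 ^ (1 - α)))) :=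
      (((continuous_id.rpow_const fun _ => Or.inr h1.le).const_mul C).const_mul K).tendsto 0
    rw [Real.zero_rpow h1.ne', mul_zero, mul_zero] at this
    exact this.mono_left nhdsWithin_le_nhds
  obtain ⟨δ, hδε, hδ0, hδ1, hδ2⟩ := ((hlim.eventually (gt_mem_nhds hε)).and
    ((eventually_mem_nhdsWithin).and (nhdsWithin_le_nhds
      ((gt_mem_nhds (sub_pos.2 hp)).and (gt_mem_nhds (sub_pos.2 hq)))))).exists
  have hδ0 : 0 < δ := hδ0
  obtain ⟨L1, hL1⟩ := exists_tendsto_sum_off_diag hα (x := x) (p := p) (q := x - δ) (by linarith)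
    (fun hc => by linarith [hc.2]) hK (fun z hz z' hz' =>
      hh z ⟨hz.1, by linarith [hz.2]⟩ z' ⟨hz'.1, by linarith [hz'.2]⟩)
  obtain ⟨L2, hL2⟩ := exists_tendsto_sum_off_diag hα (x := x) (p := x + δ) (q := q) (by linarith)
    (fun hc => by linarith [hc.1]) hK (fun z hz z' hz' =>
      hh z ⟨by linarith [hz.1], hz.2⟩ z' ⟨by linarith [hz'.1], hz'.2⟩)
  obtain ⟨L3, hL3⟩ := exists_tendsto_sum_weight hα (x := x) (s := x - δ) (t := x + δ) (by linarith)
    (by linarith) (by linarith)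
  refine ⟨_, ⟨_, (hL1.add hL2).add (hL3.mul_const (h x : ℂ))⟩, ?_⟩
  filter_upwards [hC δ hδ0, eventually_gt_atTop 0] with N hN hN0
  have hN' : (0 : ℝ) < N := by exact_mod_cast hN0
  refine le_trans ?_ ((mul_le_mul_of_nonneg_left hN hK).trans hδε.le)
  rw [← sum_lattice_add _ (by linarith : p ≤ x - δ) (by linarith : x - δ ≤ q),
    ← sum_lattice_add _ (by linarith : x - δ ≤ x + δ) (by linarith : x + δ ≤ q), Finset.sum_mul]
  rw [show ∀ a b c d : ℂ, a + (b + c) - (a + c + d) = b - d by intros; ring,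
    ← Finset.sum_sub_distrib, Finset.mul_sum]
  refine (norm_sum_le _ _).trans (Finset.sum_le_sum fun l hl => ?_)
  rw [mem_lattice] at hl
  have h2 : x - δ ≤ l / N := (le_div_iff₀ hN').2 (by linarith)
  have h3 : (l : ℝ) / N ≤ x + δ := (div_le_iff₀ hN').2 (by linarith)
  rw [← mul_sub, norm_mul, ← Complex.ofReal_sub, Complex.norm_real, Real.norm_eq_abs,
    mul_left_comm]
  exact mul_le_mul_of_nonneg_left (hh _ ⟨by linarith, by linarith⟩ x ⟨hp.le, hq.le⟩)
    (norm_nonneg _)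

/-- The lattice points of `[-n, N + n]` at relative distance at most `a` from the endpoints
of `[0, N]`, or outside of it. -/
noncomputable def tailSet (n : ℕ) (a : ℝ) (N : ℕ) : Finset ℤ :=
  (Finset.Icc (-(n : ℤ)) (N + n)).filter fun l => (l : ℝ) ≤ N * a ∨ (N : ℝ) * (1 - a) < l

/-- The averages of `|Y N|` over the end regions are uniformly small. -/
def TailSmall (n : ℕ) (Y : ℕ → ℤ → ℝ) : Prop :=
  ∀ ε > 0, ∀ᶠ a in nhdsWithin (0 : ℝ) (Set.Ioi 0), ∀ᶠ N : ℕ in atTop,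
    ∑ l ∈ tailSet n a N, |Y N l| ≤ ε * N

lemma TailSmall.sub {n : ℕ} {Y Z : ℕ → ℤ → ℝ} (hY : TailSmall n Y) (hZ : TailSmall n Z) :
    TailSmall n fun N l => Y N l - Z N l := by
  intro ε hε
  filter_upwards [hY (ε / 2) (by positivity), hZ (ε / 2) (by positivity)] with a h1 h2
  filter_upwards [h1, h2] with N h1 h2
  calc _ ≤ ∑ l ∈ tailSet n a N, (|Y N l| + |Z N l|) := Finset.sum_le_sum fun l _ => abs_sub _ _
    _ ≤ ε * N := by rw [Finset.sum_add_distrib]; linarith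

lemma sum_Icc_eq_lattice_add_tail {E : Type*} [AddCommMonoid E] (F : ℤ → E) (n : ℕ) {a : ℝ}
    (ha0 : 0 < a) (N : ℕ) :
    ∑ l ∈ Finset.Icc (-(n : ℤ)) (N + n), F l =
      ∑ l ∈ lattice a (1 - a) N, F l + ∑ l ∈ tailSet n a N, F l := by
  rw [add_comm (∑ l ∈ lattice a (1 - a) N, F l), tailSet, ← Finset.sum_filter_add_sum_filter_not (Finset.Icc (-(n : ℤ)) (N + n))
    (fun l => (l : ℝ) ≤ N * a ∨ (N : ℝ) * (1 - a) < l)]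
  congr 2
  ext l
  rw [mem_lattice, Finset.mem_filter, Finset.mem_Icc, not_or, not_le, not_lt]
  refine ⟨fun h => h.2, fun h => ⟨⟨?_, ?_⟩, h⟩⟩
  · have : (0 : ℝ) < l := lt_of_le_of_lt (by positivity) h.1
    have : 0 < l := by exact_mod_cast this
    omega
  · have : (l : ℝ) ≤ N := h.2.trans (by nlinarith [(Nat.cast_nonneg N : (0 : ℝ) ≤ N)])
    have : l ≤ N := by exact_mod_cast this
    omega

lemma TailSmall.weighted {α : ℝ} (hα : α ∈ Set.Ioo (0 : ℝ) 1) {x : ℝ} (hx : x ∈ Set.Ioo (0 : ℝ) 1)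
    {n : ℕ} {Y : ℕ → ℤ → ℝ} (hY : TailSmall n Y) {ε : ℝ} (hε : 0 < ε) :
    ∀ᶠ a in nhdsWithin (0 : ℝ) (Set.Ioi 0), ∀ᶠ N : ℕ in atTop,
      ‖∑ l ∈ tailSet n a N, weight α x N l * Y N l‖ ≤ ε := by
  have hx0 := hx.1
  have hx1 : 0 < 1 - x := by linarith [hx.2]
  obtain ⟨δ, hδ, hδx, hδx'⟩ : ∃ δ > 0, 2 * δ ≤ x ∧ 2 * δ ≤ 1 - x :=
    ⟨min x (1 - x) / 2, by positivity, by linarith [min_le_left x (1 - x)],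
      by linarith [min_le_right x (1 - x)]⟩
  obtain ⟨C, hC0, hC⟩ := eventually_norm_weight_le hα x hδ
  have hsmall : ∀ᶠ a in nhdsWithin (0 : ℝ) (Set.Ioi 0), a < δ :=
    nhdsWithin_le_nhds (gt_mem_nhds hδ)
  filter_upwards [hY (ε / (C + 1)) (by positivity), hsmall] with a h1 ha
  filter_upwards [h1, hC, eventually_gt_atTop 0] with N h1 hN hN0
  have hN' : (0 : ℝ) < N := by exact_mod_cast hN0
  calc _ ≤ ∑ l ∈ tailSet n a N, C / N * |Y N l| := by
        refine (norm_sum_le _ _).trans (Finset.sum_le_sum fun l hl => ?_)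
        rw [norm_mul, Complex.norm_real, Real.norm_eq_abs]
        refine mul_le_mul_of_nonneg_right (hN l ?_) (abs_nonneg _)
        rcases (Finset.mem_filter.1 hl).2 with h | h
        · exact le_trans (by nlinarith) (le_abs_self _)
        · rw [abs_sub_comm]
          exact le_trans (by nlinarith) (le_abs_self _)
    _ ≤ C / N * (ε / (C + 1) * N) := by
        rw [← Finset.mul_sum]
        exact mul_le_mul_of_nonneg_left h1 (by positivity)
    _ = ε * (C / (C + 1)) := by field_simp
    _ ≤ ε := mul_le_of_le_one_right hε.le ((div_le_one (by linarith)).2 (by linarith))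

lemma eventually_pos_lt_half : ∀ᶠ a in nhdsWithin (0 : ℝ) (Set.Ioi 0), 0 < a ∧ a < 1 / 2 :=
  eventually_mem_nhdsWithin.and (nhdsWithin_le_nhds (gt_mem_nhds (by norm_num)))

lemma exists_tendsto_of_tailSmall {α : ℝ} (hα : α ∈ Set.Ioo (0 : ℝ) 1) {x : ℝ}
    (hx : x ∈ Set.Ioo (0 : ℝ) 1) {n : ℕ} {Y : ℕ → ℤ → ℝ} (hY : TailSmall n Y) {g : ℝ → ℝ}
    (hg : LocLip01 g) (hYg : ∀ N : ℕ, ∀ l : ℤ, 0 < l → l < N → Y N l = g (l / N)) :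
    ∃ L, Tendsto (fun N : ℕ => ∑ l ∈ Finset.Icc (-(n : ℤ)) (N + n), weight α x N l * Y N l)
      atTop (nhds L) := by
  refine exists_tendsto_of_approx fun ε hε => ?_
  have hax : ∀ᶠ a in nhdsWithin (0 : ℝ) (Set.Ioi 0), a < x ∧ a < 1 - x :=
    nhdsWithin_le_nhds ((gt_mem_nhds hx.1).and (gt_mem_nhds (by linarith [hx.2])))
  obtain ⟨a, h1, ⟨ha0, ha1⟩, hax, hax'⟩ :=
    ((hY.weighted hα hx hε).and (eventually_pos_lt_half.and hax)).exists
  obtain ⟨K, hK⟩ := hg a (1 - a) ha0 (by linarith) (by linarith)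
  refine ⟨fun N => ∑ l ∈ lattice a (1 - a) N, weight α x N l * g (l / N),
    exists_tendsto_sum_lipschitz hα (K := max K 0) hax (by linarith) (le_max_right _ _)
      fun z hz z' hz' => (hK z hz z' hz').trans
        (mul_le_mul_of_nonneg_right (le_max_left _ _) (abs_nonneg _)), ?_⟩
  filter_upwards [h1, eventually_gt_atTop 0] with N h1 hN0
  have hN' : (0 : ℝ) < N := by exact_mod_cast hN0
  rw [sum_Icc_eq_lattice_add_tail _ n ha0]
  have : ∑ l ∈ lattice a (1 - a) N, weight α x N l * (Y N l : ℂ) =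
      ∑ l ∈ lattice a (1 - a) N, weight α x N l * (g (l / N) : ℂ) := by
    refine Finset.sum_congr rfl fun l hl => ?_
    rw [mem_lattice] at hl
    have h3 : (0 : ℝ) < l := lt_of_le_of_lt (by positivity) hl.1
    have h4 : (l : ℝ) < N := lt_of_le_of_lt hl.2 (by nlinarith)
    rw [hYg N l (by exact_mod_cast h3) (by exact_mod_cast h4)]
  rwa [this, add_sub_cancel_left]

lemma tendsto_zero_of_tailSmall {α : ℝ} (hα : α ∈ Set.Ioo (0 : ℝ) 1) {x : ℝ}
    (hx : x ∈ Set.Ioo (0 : ℝ) 1) {n : ℕ} {Y : ℕ → ℤ → ℝ} (hY : TailSmall n Y)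
    (hmid : ∀ a : ℝ, 0 < a → a < 1 / 2 → ∃ K : ℝ, ∀ᶠ N : ℕ in atTop,
      ∀ l ∈ lattice a (1 - a) N, |Y N l| ≤ K / N) :
    Tendsto (fun N : ℕ => ∑ l ∈ Finset.Icc (-(n : ℤ)) (N + n), weight α x N l * Y N l)
      atTop (nhds 0) := by
  rw [Metric.tendsto_nhds]
  intro ε hε
  obtain ⟨a, h1, ha0, ha1⟩ :=
    ((hY.weighted hα hx (half_pos hε)).and eventually_pos_lt_half).exists
  obtain ⟨K', hK'⟩ := hmid a ha0 ha1
  set K := max K' 0 with hKdef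
  have hK0 : 0 ≤ K := le_max_right _ _
  have hsum := summable_norm_phiHat hα
  set B := ∑' m : ℤ, ‖phiHat α m‖ with hB
  have hlim : Tendsto (fun N : ℕ => (N : ℝ) ^ (-(1 - α)) * (K * B)) atTop (nhds 0) := by
    simpa using ((tendsto_rpow_neg_atTop (by linarith [hα.2] : 0 < 1 - α)).comp
      (tendsto_natCast_atTop_atTop (R := ℝ))).mul_const (K * B)
  filter_upwards [h1, hK', hlim.eventually (gt_mem_nhds (half_pos hε)),
    eventually_gt_atTop 0] with N h1 hK h2 hN0
  have hN' : (0 : ℝ) < N := by exact_mod_cast hN0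
  rw [dist_zero_right, sum_Icc_eq_lattice_add_tail _ n ha0]
  refine lt_of_le_of_lt (norm_add_le _ _) ?_
  have e : (N : ℝ) ^ (-(1 - α)) = N ^ α / N := by
    rw [neg_sub, Real.rpow_sub hN', Real.rpow_one]
  rw [e] at h2
  have hmain : ‖∑ l ∈ lattice a (1 - a) N, weight α x N l * (Y N l : ℂ)‖ ≤
      N ^ α / N * (K * B) := by
    calc _ ≤ ∑ l ∈ lattice a (1 - a) N, N ^ α * (K / N) * ‖phiHat α (⌊(N : ℝ) * x⌋ - l)‖ := by
          refine (norm_sum_le _ _).trans (Finset.sum_le_sum fun l hl => ?_)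
          rw [norm_mul, weight, norm_mul, Complex.norm_real, Complex.norm_real,
            Real.norm_of_nonneg (by positivity), Real.norm_eq_abs, mul_right_comm]
          gcongr
          exact (hK l hl).trans (div_le_div_of_nonneg_right (le_max_left _ _) hN'.le)
      _ ≤ N ^ α * (K / N) * B := by
          rw [← Finset.mul_sum]
          refine mul_le_mul_of_nonneg_left ?_ (by positivity)
          rw [← Finset.sum_image (f := fun m : ℤ => ‖phiHat α m‖)
            (g := fun l : ℤ => ⌊(N : ℝ) * x⌋ - l) (by intro a _ b _ hab; simpa using hab)]
          exact hsum.sum_le_tsum _ fun _ _ => norm_nonneg _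
      _ = _ := by ring
  linarith

lemma sum_Icc_central_diff_le (W : ℤ → ℝ) (hW : ∀ m, 0 ≤ W m) (hmono : Monotone W) (n : ℕ)
    (A B : ℤ) : ∑ l ∈ Finset.Icc A B, (W (l + n) - W (l - n)) ≤ 2 * n * W (B + n) := by
  rcases lt_or_ge B (A - 1) with hlt | hle
  · rw [Finset.Icc_eq_empty (by omega), Finset.sum_empty]
    have := hW (B + n)
    positivity
  have key : ∀ B, A - 1 ≤ B → ∑ l ∈ Finset.Icc A B, (W (l + n) - W (l - n)) =
      ∑ i ∈ Finset.range (2 * n), (W (B + n - i) - W (A - 1 + n - i)) := by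
    intro B hB
    induction B, hB using Int.leInduction with
    | base => simp
    | succ B hB ih =>
      have hset : Finset.Icc A (B + 1) = insert (B + 1) (Finset.Icc A B) := by
        ext l; simp only [Finset.mem_Icc, Finset.mem_insert]; omega
      have htel := Finset.sum_range_sub' (fun i : ℕ => W (B + 1 + n - i)) (2 * n)
      rw [hset, Finset.sum_insert (by simp), ih]
      have e : W (B + 1 + n) - W (B + 1 - n) = ∑ i ∈ Finset.range (2 * n),
          (W (B + 1 + n - i) - W (B + n - i)) := by
        rw [show W (B + 1 + n) - W (B + 1 - n) =
          W (B + 1 + n - (0 : ℕ)) - W (B + 1 + n - ((2 * n : ℕ) : ℤ)) by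
            push_cast; congr 2 <;> ring, ← htel]
        refine Finset.sum_congr rfl fun i _ => ?_
        push_cast
        congr 2; ring
      rw [e, ← Finset.sum_add_distrib]
      exact Finset.sum_congr rfl fun i _ => by ring
  rw [key B hle]
  calc _ ≤ ∑ _i ∈ Finset.range (2 * n), W (B + n) :=
        Finset.sum_le_sum fun i _ => by
          linarith [hW (A - 1 + n - i), hmono (by omega : B + n - i ≤ B + n)]
    _ = 2 * n * W (B + n) := by simp

/-- A primitive of `C * t ^ (-γ)`, extended by zero to the negative axis. -/
noncomputable def tailMajorant (C γ t : ℝ) : ℝ := C / (1 - γ) * (max t 0) ^ (1 - γ)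

lemma tailMajorant_nonneg {C γ : ℝ} (hC : 0 ≤ C) (hγ : γ < 1) (t : ℝ) :
    0 ≤ tailMajorant C γ t :=
  mul_nonneg (div_nonneg hC (by linarith)) (Real.rpow_nonneg (le_max_right _ _) _)

lemma tailMajorant_mono {C γ : ℝ} (hC : 0 ≤ C) (hγ : γ < 1) : Monotone (tailMajorant C γ) := by
  intro s t hst
  refine mul_le_mul_of_nonneg_left ?_ (div_nonneg hC (by linarith))
  exact Real.rpow_le_rpow (le_max_right _ _) (max_le_max_right 0 hst) (by linarith)

lemma sum_abs_le_of_tailMajorant {C γ : ℝ} (hC : 0 ≤ C) (hγ : γ < 1) {n N : ℕ} (hN : 0 < N)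
    {a : ℝ} (hna : n ≤ a * N) {e : ℤ → ℝ}
    (he : ∀ l : ℤ, (l : ℝ) ≤ N * a → |e l| ≤
      N * (tailMajorant C γ ((l + n) / N) - tailMajorant C γ ((l - n) / N))) :
    ∑ l ∈ Finset.Icc (-(n : ℤ)) ⌊(N : ℝ) * a⌋, |e l| ≤
      2 * n * tailMajorant C γ (2 * a) * N := by
  have hN' : (0 : ℝ) < N := by exact_mod_cast hN
  have h1 := sum_Icc_central_diff_le (fun m => N * tailMajorant C γ (m / N))
    (fun m => mul_nonneg hN'.le (tailMajorant_nonneg hC hγ _))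
    (fun m m' h => mul_le_mul_of_nonneg_left (tailMajorant_mono hC hγ
      (div_le_div_of_nonneg_right (by exact_mod_cast h) hN'.le)) hN'.le)
    n (-(n : ℤ)) ⌊(N : ℝ) * a⌋
  push_cast at h1
  calc ∑ l ∈ Finset.Icc (-(n : ℤ)) ⌊(N : ℝ) * a⌋, |e l|
      ≤ 2 * n * (N * tailMajorant C γ ((⌊(N : ℝ) * a⌋ + n) / N)) :=
        (Finset.sum_le_sum fun l hl => (he l (Int.le_floor.1 (Finset.mem_Icc.1 hl).2)).trans
          (le_of_eq (mul_sub _ _ _))).trans h1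
    _ ≤ 2 * n * tailMajorant C γ (2 * a) * N := by
        have : tailMajorant C γ ((⌊(N : ℝ) * a⌋ + n) / N) ≤ tailMajorant C γ (2 * a) := by
          refine tailMajorant_mono hC hγ ?_
          rw [div_le_iff₀ hN']
          linarith [Int.floor_le ((N : ℝ) * a)]
        have h2 := mul_le_mul_of_nonneg_left this (by positivity : (0 : ℝ) ≤ 2 * n * N)
        linarith

lemma tailSmall_of_tailMajorant {C γ a₀ : ℝ} (hC : 0 ≤ C) (hγ : γ < 1) (ha₀ : 0 < a₀) {n : ℕ}
    {Y : ℕ → ℤ → ℝ}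
    (hleft : ∀ᶠ N : ℕ in atTop, ∀ l : ℤ, (l : ℝ) ≤ N * a₀ → |Y N l| ≤
      N * (tailMajorant C γ ((l + n) / N) - tailMajorant C γ ((l - n) / N)))
    (hright : ∀ᶠ N : ℕ in atTop, ∀ l : ℤ, (l : ℝ) ≤ N * a₀ → |Y N (N - l)| ≤
      N * (tailMajorant C γ ((l + n) / N) - tailMajorant C γ ((l - n) / N))) :
    TailSmall n Y := by
  intro ε hε
  have h1 : 0 < 1 - γ := by linarith
  have hlim : Tendsto (fun a : ℝ => 4 * n * tailMajorant C γ (2 * a))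
      (nhdsWithin 0 (Set.Ioi 0)) (nhds 0) := by
    have hc : Continuous fun a : ℝ => 4 * n * (C / (1 - γ) * (max (2 * a) 0) ^ (1 - γ)) := by
      refine continuous_const.mul (continuous_const.mul (Continuous.rpow_const ?_ fun _ =>
        Or.inr h1.le))
      fun_prop
    have := hc.tendsto 0
    simp only [mul_zero, max_self, Real.zero_rpow h1.ne'] at this
    exact this.mono_left nhdsWithin_le_nhds
  filter_upwards [hlim.eventually (gt_mem_nhds hε), eventually_mem_nhdsWithin,
    nhdsWithin_le_nhds (gt_mem_nhds ha₀)] with a hε' ha haa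
  have ha : 0 < a := ha
  filter_upwards [hleft, hright, eventually_gt_atTop 0,
    (tendsto_natCast_atTop_atTop (R := ℝ)).eventually_ge_atTop (n / a)] with N hl hr hN0 hNa
  have hN' : (0 : ℝ) < N := by exact_mod_cast hN0
  rw [div_le_iff₀ ha, mul_comm] at hNa
  have hmon : (N : ℝ) * a ≤ N * a₀ := mul_le_mul_of_nonneg_left haa.le hN'.le
  have h1 := sum_abs_le_of_tailMajorant hC hγ hN0 hNa (e := Y N) fun l h => hl l (h.trans hmon)
  have h2 := sum_abs_le_of_tailMajorant hC hγ hN0 hNa (e := fun l => Y N (N - l))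
    fun l h => hr l (h.trans hmon)
  have hinj : Set.InjOn (fun l : ℤ => (N : ℤ) - l) (Finset.Icc (-(n : ℤ)) ⌊(N : ℝ) * a⌋) := by
    intro a _ b _ hab; simpa using hab
  rw [← Finset.sum_image (f := fun l => |Y N l|) hinj] at h2
  have hsub : tailSet n a N ⊆ Finset.Icc (-(n : ℤ)) ⌊(N : ℝ) * a⌋ ∪
      (Finset.Icc (-(n : ℤ)) ⌊(N : ℝ) * a⌋).image fun l : ℤ => (N : ℤ) - l := by
    intro l hl
    rw [tailSet, Finset.mem_filter, Finset.mem_Icc] at hl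
    rw [Finset.mem_union, Finset.mem_Icc, Finset.mem_image]
    rcases hl.2 with h | h
    · exact Or.inl ⟨hl.1.1, Int.le_floor.2 h⟩
    · refine Or.inr ⟨N - l, Finset.mem_Icc.2 ⟨by omega, Int.le_floor.2 ?_⟩, by ring⟩
      push_cast; linarith
  refine (Finset.sum_le_sum_of_subset_of_nonneg hsub fun _ _ _ => abs_nonneg _).trans ?_
  have h3 := Finset.sum_union_inter (s₁ := Finset.Icc (-(n : ℤ)) ⌊(N : ℝ) * a⌋)
    (s₂ := (Finset.Icc (-(n : ℤ)) ⌊(N : ℝ) * a⌋).image fun l : ℤ => (N : ℤ) - l)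
    (f := fun l => |Y N l|)
  have h4 := Finset.sum_nonneg (s := Finset.Icc (-(n : ℤ)) ⌊(N : ℝ) * a⌋ ∩
    (Finset.Icc (-(n : ℤ)) ⌊(N : ℝ) * a⌋).image fun l : ℤ => (N : ℤ) - l)
    fun l _ => abs_nonneg (Y N l)
  linarith [mul_le_mul_of_nonneg_right hε'.le hN'.le]

lemma hasDerivAt_tailMajorant {C γ : ℝ} (hγ : γ < 1) {t : ℝ} (ht : 0 < t) :
    HasDerivAt (tailMajorant C γ) (C * t ^ (-γ)) t := by
  have h1 : 1 - γ ≠ 0 := by linarith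
  have h := (Real.hasDerivAt_rpow_const (p := 1 - γ) (Or.inl ht.ne')).const_mul (C / (1 - γ))
  have e : C / (1 - γ) * ((1 - γ) * t ^ (1 - γ - 1)) = C * t ^ (-γ) := by
    rw [show 1 - γ - 1 = -γ by ring]; field_simp
  rw [e] at h
  refine h.congr_of_eventuallyEq ?_
  filter_upwards [lt_mem_nhds ht] with s hs
  rw [tailMajorant, max_eq_left hs.le]

lemma continuous_tailMajorant {C γ : ℝ} (hγ : γ < 1) : Continuous (tailMajorant C γ) :=
  continuous_const.mul (Continuous.rpow_const (by fun_prop) fun _ => Or.inr (by linarith))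

lemma abs_sub_le_tailMajorant {C γ a : ℝ} (hγ : γ < 1) (ha : 0 < a) {u g : ℝ → ℝ}
    (hu : Continuous u) (hu0 : ∀ t ≤ 0, u t = 0) (hd : ∀ t ∈ Set.Ioo 0 a, HasDerivAt u (g t) t)
    (hg : ∀ t ∈ Set.Ioo 0 a, |g t| ≤ C * t ^ (-γ)) {s t : ℝ} (hst : s ≤ t) (ht : t < a) :
    |u t - u s| ≤ tailMajorant C γ t - tailMajorant C γ s := by
  have hmax : ∀ r, u r = u (max r 0) ∧ tailMajorant C γ r = tailMajorant C γ (max r 0) := by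
    intro r
    rcases le_total r 0 with h | h
    · rw [max_eq_right h, hu0 r h, hu0 0 le_rfl, tailMajorant, tailMajorant, max_eq_right h,
        max_self]
      exact ⟨rfl, rfl⟩
    · rw [max_eq_left h]
      exact ⟨rfl, rfl⟩
  have key : ∀ σ : ℝ, |σ| = 1 → MonotoneOn (fun r => tailMajorant C γ r + σ * u r)
      (Set.Icc 0 (max t 0)) := by
    intro σ hσ
    have hder : ∀ r ∈ Set.Ioo 0 (max t 0), HasDerivAt (fun r => tailMajorant C γ r + σ * u r)
        (C * r ^ (-γ) + σ * g r) r := fun r hr =>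
      (hasDerivAt_tailMajorant hγ hr.1).add
        ((hd r ⟨hr.1, hr.2.trans (max_lt ht ha)⟩).const_mul σ)
    refine monotoneOn_of_deriv_nonneg (convex_Icc _ _)
      ((continuous_tailMajorant hγ).add (continuous_const.mul hu)).continuousOn ?_ ?_
    · rw [interior_Icc]
      exact fun r hr => (hder r hr).differentiableAt.differentiableWithinAt
    · rw [interior_Icc]
      intro r hr
      rw [(hder r hr).deriv]
      have h1 := hg r ⟨hr.1, hr.2.trans (max_lt ht ha)⟩
      have h2 := neg_abs_le (σ * g r)
      rw [abs_mul, hσ, one_mul] at h2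
      linarith
  have hs : max s 0 ∈ Set.Icc 0 (max t 0) := ⟨le_max_right _ _, max_le_max_right 0 hst⟩
  have htt : max t 0 ∈ Set.Icc 0 (max t 0) := ⟨le_max_right _ _, le_rfl⟩
  have h1 := key 1 (by simp) hs htt hs.2
  have h2 := key (-1) (by simp) hs htt hs.2
  rw [(hmax t).1, (hmax t).2, (hmax s).1, (hmax s).2, abs_le]
  constructor <;> linarith

/-- The extension by zero of a function on `(0, 1)`. -/
noncomputable def zeroExt (h : ℝ → ℝ) : ℝ → ℝ := (Set.Ioo 0 1).indicator h

lemma zeroExt_of_mem {h : ℝ → ℝ} {t : ℝ} (ht : t ∈ Set.Ioo (0 : ℝ) 1) : zeroExt h t = h t :=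
  Set.indicator_of_mem ht h

lemma zeroExt_of_notMem {h : ℝ → ℝ} {t : ℝ} (ht : t ∉ Set.Ioo (0 : ℝ) 1) : zeroExt h t = 0 :=
  Set.indicator_of_notMem ht h

lemma abs_zeroExt_le (h : ℝ → ℝ) (t : ℝ) : |zeroExt h t| ≤ |h t| :=
  norm_indicator_le_norm_self h t

lemma continuous_zeroExt {h : ℝ → ℝ} (hc : Continuous h) (h0 : h 0 = 0) (h1 : h 1 = 0) :
    Continuous (zeroExt h) := by
  refine hc.indicator fun t ht => ?_
  rw [frontier_Ioo one_pos] at ht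
  rcases ht with rfl | rfl
  exacts [h0, h1]

lemma hasDerivAt_zeroExt_of_mem {h : ℝ → ℝ} {h' t : ℝ} (ht : t ∈ Set.Ioo (0 : ℝ) 1)
    (hd : HasDerivAt h h' t) : HasDerivAt (zeroExt h) h' t := by
  refine hd.congr_of_eventuallyEq ?_
  filter_upwards [isOpen_Ioo.mem_nhds ht] with s hs using zeroExt_of_mem hs

lemma hasDerivAt_zeroExt {h : ℝ → ℝ} (hd : Differentiable ℝ h) (h0 : h 0 = 0) (h1 : h 1 = 0)
    (h0' : deriv h 0 = 0) (h1' : deriv h 1 = 0) (t : ℝ) :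
    HasDerivAt (zeroExt h) (zeroExt (deriv h) t) t := by
  by_cases ht : t ∈ Set.Ioo (0 : ℝ) 1
  · rw [zeroExt_of_mem ht]
    exact hasDerivAt_zeroExt_of_mem ht (hd t).hasDerivAt
  rw [zeroExt_of_notMem ht]
  by_cases ht' : t ∈ Set.Icc (0 : ℝ) 1
  · have hb : h t = 0 ∧ deriv h t = 0 := by
      rcases ht'.1.eq_or_lt with rfl | h2
      · exact ⟨h0, h0'⟩
      rcases ht'.2.eq_or_lt with rfl | h3
      · exact ⟨h1, h1'⟩
      exact absurd ⟨h2, h3⟩ ht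
    have hdt := (hd t).hasDerivAt
    rw [hb.2, hasDerivAt_iff_isLittleO] at hdt
    rw [hasDerivAt_iff_isLittleO]
    simp only [hb.1, zeroExt_of_notMem ht, smul_zero, sub_zero] at hdt ⊢
    exact (isBigO_of_le _ fun s => abs_zeroExt_le h s).trans_isLittleO hdt
  · refine (hasDerivAt_const t (0 : ℝ)).congr_of_eventuallyEq ?_
    filter_upwards [isClosed_Icc.isOpen_compl.mem_nhds ht'] with s hs
    exact zeroExt_of_notMem fun h => hs (Set.Ioo_subset_Icc_self h)

/-- The symmetric difference operator with step `h`. -/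
def centralDiff (h : ℝ) (u : ℝ → ℝ) (t : ℝ) : ℝ := u (t + h) - u (t - h)

lemma exists_centralDiff_eq {h : ℝ} (hh : 0 < h) {u g : ℝ → ℝ} {t : ℝ}
    (hd : ∀ s ∈ Set.Icc (t - h) (t + h), HasDerivAt u (g s) s) :
    ∃ ξ, |ξ - t| ≤ h ∧ centralDiff h u t = 2 * h * g ξ := by
  obtain ⟨ξ, hξ, e⟩ := exists_hasDerivAt_eq_slope u g (by linarith : t - h < t + h)
    (fun s hs => (hd s hs).continuousAt.continuousWithinAt)
    (fun s hs => hd s (Set.Ioo_subset_Icc_self hs))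
  refine ⟨ξ, abs_le.2 ⟨by linarith [hξ.1], by linarith [hξ.2]⟩, ?_⟩
  rw [e, centralDiff, show t + h - (t - h) = 2 * h by ring]
  field_simp

lemma exists_iterate_centralDiff_eq {h : ℝ} (hh : 0 < h) (M : ℕ) : ∀ u : ℕ → ℝ → ℝ,
    (∀ j < M, ∀ t, HasDerivAt (u j) (u (j + 1) t) t) → ∀ t, ∃ ξ, |ξ - t| ≤ M * h ∧
      (centralDiff h)^[M] (u 0) t = (2 * h) ^ M * u M ξ := by
  induction M with
  | zero => exact fun u _ t => ⟨t, by simp, by simp⟩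
  | succ M ih =>
    intro u hu t
    obtain ⟨ξ, hξ, e⟩ := ih (fun j => centralDiff h (u j)) (fun j hj t =>
      ((hu j (by omega) (t + h)).comp_add_const t h).sub
        ((hu j (by omega) (t - h)).comp_sub_const t h)) t
    obtain ⟨ζ, hζ, e'⟩ := exists_centralDiff_eq hh (u := u M) (t := ξ)
      fun s _ => hu M (by omega) s
    refine ⟨ζ, ?_, ?_⟩
    · push_cast
      have := abs_sub_le ζ ξ t
      linarith
    · rw [Function.iterate_succ_apply, e, e']
      ring

lemma tailSmall_of_secant {C γ a : ℝ} (hC : 0 ≤ C) (hγ : γ < 1) (ha : 0 < a) (ha1 : a ≤ 1)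
    {u g : ℝ → ℝ} (hu : Continuous u) (hu0 : ∀ t, t ∉ Set.Ioo (0 : ℝ) 1 → u t = 0)
    (hd : ∀ t ∈ Set.Ioo (0 : ℝ) 1, HasDerivAt u (g t) t)
    (hg : ∀ t ∈ Set.Ioo 0 a, |g t| ≤ C * t ^ (-γ))
    (hg' : ∀ t ∈ Set.Ioo 0 a, |g (1 - t)| ≤ C * t ^ (-γ)) {n : ℕ} {Y : ℕ → ℤ → ℝ}
    (hY : ∀ N : ℕ, 0 < N → ∀ l : ℤ, ∃ ξ : ℝ, |ξ - l / N| + 1 / N ≤ n / N ∧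
      Y N l = N / 2 * centralDiff (1 / N) u ξ) : TailSmall n Y := by
  have hleft : ∀ s t, s ≤ t → t < a → |u t - u s| ≤ tailMajorant C γ t - tailMajorant C γ s :=
    fun s t hst ht => abs_sub_le_tailMajorant hγ ha hu (fun r hr => hu0 r fun h => h.1.not_ge hr)
      (fun r hr => hd r ⟨hr.1, hr.2.trans_le ha1⟩) hg hst ht
  have hright : ∀ s t, s ≤ t → t < a →
      |u (1 - t) - u (1 - s)| ≤ tailMajorant C γ t - tailMajorant C γ s := by
    refine fun s t hst ht => abs_sub_le_tailMajorant (u := fun r => u (1 - r))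
      (g := fun r => -g (1 - r)) hγ ha (hu.comp (by fun_prop))
      (fun r hr => hu0 _ fun h => by linarith [h.2])
      (fun r hr => ?_) (fun r hr => by rw [abs_neg]; exact hg' r hr) hst ht
    exact (hd (1 - r) ⟨by linarith [hr.2], by linarith [hr.1]⟩).comp_const_sub 1 r
  have hbound : ∀ᶠ N : ℕ in atTop, 0 < N ∧ (n : ℝ) < N * (a / 2) := by
    filter_upwards [eventually_gt_atTop 0, (tendsto_natCast_atTop_atTop (R := ℝ)).eventually_gt_atTop
      (n / (a / 2))] with N hN h
    exact ⟨hN, (div_lt_iff₀ (by positivity)).1 h⟩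
  have fin : ∀ N : ℕ, 0 < N → (n : ℝ) < N * (a / 2) → ∀ (l : ℤ) (ξ d : ℝ),
      (l : ℝ) ≤ N * (a / 2) → |ξ - l / N| + 1 / N ≤ n / N →
      (ξ + 1 / N < a → |d| ≤ tailMajorant C γ (ξ + 1 / N) - tailMajorant C γ (ξ - 1 / N)) →
      |N / 2 * d| ≤ N * (tailMajorant C γ ((l + n) / N) - tailMajorant C γ ((l - n) / N)) := by
    intro N hN hn l ξ d hl hξ hd
    have hN' : (0 : ℝ) < N := by exact_mod_cast hN
    have h1 := neg_abs_le (ξ - l / N)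
    have h2 := le_abs_self (ξ - l / N)
    have e1 : ((l : ℝ) + n) / N = l / N + n / N := add_div _ _ _
    have e2 : ((l : ℝ) - n) / N = l / N - n / N := sub_div _ _ _
    have h3 : ((l : ℝ) + n) / N < a := by
      rw [div_lt_iff₀ hN']; linarith
    have m1 := tailMajorant_mono hC hγ (by linarith : ξ + 1 / N ≤ (l + n) / N)
    have m2 := tailMajorant_mono hC hγ (by linarith : ((l : ℝ) - n) / N ≤ ξ - 1 / N)
    have h4 := hd (by linarith)
    rw [abs_mul, abs_of_pos (by positivity)]
    have h5 := mul_le_mul_of_nonneg_left (h4.trans (by linarith :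
      _ ≤ tailMajorant C γ ((l + n) / N) - tailMajorant C γ ((l - n) / N))) hN'.le
    nlinarith [mul_nonneg hN'.le (abs_nonneg d)]
  refine tailSmall_of_tailMajorant hC hγ (half_pos ha) ?_ ?_
  · filter_upwards [hbound] with N ⟨hN, hn⟩ l hl
    obtain ⟨ξ, hξ, e⟩ := hY N hN l
    rw [e]
    refine fin N hN hn l ξ _ hl hξ fun h => hleft _ _ ?_ h
    have : (0 : ℝ) ≤ 1 / N := by positivity
    linarith
  · filter_upwards [hbound] with N ⟨hN, hn⟩ l hl
    obtain ⟨ξ, hξ, e⟩ := hY N hN (N - l)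
    have hN' : (N : ℝ) ≠ 0 := by exact_mod_cast hN.ne'
    rw [e]
    refine fin N hN hn l (1 - ξ) _ hl ?_ fun h => ?_
    · rw [show 1 - ξ - l / N = -(ξ - ((N - l : ℤ) : ℝ) / N) by push_cast; field_simp; ring, abs_neg]
      exact hξ
    · have : (0 : ℝ) ≤ 1 / N := by positivity
      have h6 := hright (1 - ξ - 1 / N) (1 - ξ + 1 / N) (by linarith) h
      rw [abs_sub_comm] at h6
      convert h6 using 3
      rw [centralDiff]
      congr 2 <;> ring

lemma tailSmall_zeroExt {C γ a : ℝ} (hC : 0 ≤ C) (hγ : γ ∈ Set.Ico (0 : ℝ) 1) (ha : 0 < a)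
    {g : ℝ → ℝ} (hg : ∀ t ∈ Set.Ioo 0 a, |g t| ≤ C * t ^ (-γ))
    (hg' : ∀ t ∈ Set.Ioo 0 a, |g (1 - t)| ≤ C * t ^ (-γ)) {n : ℕ} (hn : 0 < n) :
    TailSmall n fun N l => zeroExt g (l / N) := by
  have fin : ∀ N : ℕ, 0 < N → ∀ (l : ℤ) (d : ℝ), (l ≤ 0 → d = 0) →
      (0 < l → |d| ≤ C * ((l : ℝ) / N) ^ (-γ)) →
      |d| ≤ N * (tailMajorant C γ ((l + n) / N) - tailMajorant C γ ((l - n) / N)) := by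
    intro N hN l d h0 hd
    have hN' : (0 : ℝ) < N := by exact_mod_cast hN
    have hn' : (1 : ℝ) ≤ n := by exact_mod_cast hn
    have m1 := tailMajorant_mono hC hγ.2 (div_le_div_of_nonneg_right (by linarith) hN'.le :
      (l : ℝ) / N ≤ (l + n) / N)
    have m2 := tailMajorant_mono hC hγ.2 (div_le_div_of_nonneg_right (by linarith) hN'.le :
      ((l : ℝ) - n) / N ≤ (l - 1) / N)
    have m3 := tailMajorant_mono hC hγ.2 (div_le_div_of_nonneg_right (by linarith) hN'.le :
      ((l : ℝ) - 1) / N ≤ l / N)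
    rcases le_or_gt l 0 with hl | hl
    · rw [h0 hl, abs_zero]
      exact mul_nonneg hN'.le (by linarith)
    have hl1 : (1 : ℝ) ≤ l := by exact_mod_cast hl
    have key := mul_rpow_neg_le_sub hγ (t := l / N) (h := 1 / N) (by positivity)
      (div_le_div_of_nonneg_right hl1 hN'.le)
    have hpos : 0 < 1 - γ := by linarith [hγ.2]
    have h5 : C * ((l : ℝ) / N) ^ (-γ) ≤
        N * (tailMajorant C γ (l / N) - tailMajorant C γ ((l - 1) / N)) := by
      rw [tailMajorant, tailMajorant, max_eq_left (by positivity), max_eq_left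
        (div_nonneg (by linarith) hN'.le), sub_div]
      have := mul_le_mul_of_nonneg_left key (by positivity : 0 ≤ N * (C / (1 - γ)))
      calc _ = N * (C / (1 - γ)) * (1 / N * ((1 - γ) * ((l : ℝ) / N) ^ (-γ))) := by field_simp
        _ ≤ _ := this
        _ = _ := by ring
    refine ((hd hl).trans h5).trans (mul_le_mul_of_nonneg_left (by linarith) hN'.le)
  have hpos : ∀ t : ℝ, 0 < t → 0 ≤ C * t ^ (-γ) := fun t ht => by positivity
  refine tailSmall_of_tailMajorant hC hγ.2 (half_pos ha) ?_ ?_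
  · filter_upwards [eventually_gt_atTop 0] with N hN l hl
    have hN' : (0 : ℝ) < N := by exact_mod_cast hN
    have hla : (l : ℝ) / N < a := by rw [div_lt_iff₀ hN']; nlinarith
    refine fin N hN l _ (fun h => zeroExt_of_notMem fun h' => ?_) fun h => ?_
    · have h0 : (l : ℝ) ≤ 0 := by exact_mod_cast h
      exact h'.1.not_ge (div_nonpos_of_nonpos_of_nonneg h0 hN'.le)
    · have h0 : (0 : ℝ) < l := by exact_mod_cast h
      have h1 : (0 : ℝ) < l / N := by positivity
      refine le_trans ?_ (hg _ ⟨h1, hla⟩)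
      exact abs_zeroExt_le _ _
  · filter_upwards [eventually_gt_atTop 0] with N hN l hl
    have hN' : (0 : ℝ) < N := by exact_mod_cast hN
    have hla : (l : ℝ) / N < a := by rw [div_lt_iff₀ hN']; nlinarith
    have e : ((N - l : ℤ) : ℝ) / N = 1 - l / N := by push_cast; field_simp
    rw [e]
    refine fin N hN l _ (fun h => zeroExt_of_notMem fun h' => ?_) fun h => ?_
    · have h0 : (l : ℝ) ≤ 0 := by exact_mod_cast h
      linarith [h'.2, div_nonpos_of_nonpos_of_nonneg h0 hN'.le]
    · have h0 : (0 : ℝ) < l := by exact_mod_cast h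
      have h1 : (0 : ℝ) < l / N := by positivity
      refine le_trans ?_ (hg' _ ⟨h1, hla⟩)
      exact abs_zeroExt_le _ _

/-- The symmetric difference of a two-sided sequence. -/
def latticeDiff (Y : ℤ → ℂ) (l : ℤ) : ℂ := Y (l + 1) - Y (l - 1)

lemma latticeDiff_eq_zero {Y : ℤ → ℂ} {A B : ℤ} (hY : ∀ l, l ∉ Finset.Icc A B → Y l = 0) :
    ∀ l, l ∉ Finset.Icc (A - 1) (B + 1) → latticeDiff Y l = 0 := by
  intro l hl
  rw [Finset.mem_Icc] at hl
  rw [latticeDiff, hY _ (by rw [Finset.mem_Icc]; omega), hY _ (by rw [Finset.mem_Icc]; omega),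
    sub_zero]

lemma iterate_latticeDiff_eq_zero (n : ℕ) : ∀ (Y : ℤ → ℂ) (A B : ℤ),
    (∀ l, l ∉ Finset.Icc A B → Y l = 0) →
    ∀ l, l ∉ Finset.Icc (A - n) (B + n) → latticeDiff^[n] Y l = 0 := by
  induction n with
  | zero => simp
  | succ n ih =>
    intro Y A B hY l hl
    rw [Function.iterate_succ_apply]
    refine ih _ _ _ (latticeDiff_eq_zero hY) l fun h => hl ?_
    rw [Finset.mem_Icc] at h ⊢
    push_cast
    omega

lemma tsum_phiHat_add_one {β : ℝ} (hβ : 0 < β) (k : ℤ) {Y : ℤ → ℂ} {A B : ℤ}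
    (hY : ∀ l, l ∉ Finset.Icc A B → Y l = 0) :
    ∑' l, phiHat (β + 1) (k - l) * Y l = ∑' l, phiHat β (k - l) * latticeDiff Y l := by
  have hs : ∀ (w : ℤ → ℂ) (c : ℤ), Summable fun l => w l * Y (l + c) := fun w c =>
    summable_of_ne_finset_zero (s := Finset.Icc (A - c) (B - c)) fun l hl => by
      rw [hY, mul_zero]
      rw [Finset.mem_Icc] at hl ⊢
      omega
  have shift : ∀ (w : ℤ → ℂ) (c : ℤ), ∑' l, w (l + c) * Y (l + c) = ∑' l, w l * Y l :=
    fun w c => (Equiv.addRight c).tsum_eq fun l => w l * Y l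
  have h1 := shift (fun l => phiHat β (k - l + 1)) 1
  have h2 := shift (fun l => phiHat β (k - l - 1)) (-1)
  calc ∑' l, phiHat (β + 1) (k - l) * Y l
      = ∑' l, (phiHat β (k - l + 1) * Y (l + 0) - phiHat β (k - l - 1) * Y (l + 0)) := by
        simp only [phiHat_add_one hβ, sub_mul, add_zero]
    _ = ∑' l, phiHat β (k - l + 1) * Y l - ∑' l, phiHat β (k - l - 1) * Y l := by
        rw [(hs _ 0).tsum_sub (hs _ 0)]
        simp only [add_zero]
    _ = ∑' l, phiHat β (k - l) * Y (l + 1) - ∑' l, phiHat β (k - l) * Y (l + -1) := by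
        rw [← h1, ← h2]
        congr 1 <;> refine tsum_congr fun l => ?_ <;> congr 2 <;> ring
    _ = _ := by
        rw [← (hs _ 1).tsum_sub (hs _ (-1))]
        exact tsum_congr fun l => by rw [latticeDiff, mul_sub, ← sub_eq_add_neg]

lemma tsum_phiHat_add_nat {β : ℝ} (hβ : 0 < β) (k : ℤ) (n : ℕ) : ∀ (Y : ℤ → ℂ) (A B : ℤ),
    (∀ l, l ∉ Finset.Icc A B → Y l = 0) →
    ∑' l, phiHat (β + n) (k - l) * Y l = ∑' l, phiHat β (k - l) * latticeDiff^[n] Y l := by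
  induction n with
  | zero => simp
  | succ n ih =>
    intro Y A B hY
    rw [Nat.cast_succ, ← add_assoc, tsum_phiHat_add_one (by positivity) k hY,
      ih _ _ _ (latticeDiff_eq_zero hY), Function.iterate_succ_apply]

lemma iterate_latticeDiff_sample (n N : ℕ) (F : ℝ → ℝ) (l : ℤ) :
    latticeDiff^[n] (fun l => ((F (l / N) : ℝ) : ℂ)) l =
      ((centralDiff (1 / N))^[n] F (l / N) : ℝ) := by
  have h : Function.Semiconj (fun (F : ℝ → ℝ) (l : ℤ) => ((F (l / N) : ℝ) : ℂ))
      (centralDiff (1 / N)) latticeDiff := fun F => by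
    funext l
    simp [centralDiff, latticeDiff, add_div, sub_div]
  exact (congrFun (h.iterate_right n F) l).symm

lemma sum_Xvec_eq_tsum (w : ℤ → ℂ) (h : ℝ → ℝ) {N : ℕ} (hN : 0 < N) :
    ∑ l ∈ Finset.range (N + 1), w l * ((Xvec h N l : ℝ) : ℂ) =
      ∑' l : ℤ, w l * ((zeroExt h (l / N) : ℝ) : ℂ) := by
  have hN' : (0 : ℝ) < N := by exact_mod_cast hN
  have hsupp : ∀ l : ℤ, ¬ (0 < l ∧ l < N) → zeroExt h (l / N) = 0 := by
    refine fun l hl => zeroExt_of_notMem fun ht => hl ?_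
    have h1 : (0 : ℝ) < l := by simpa using (lt_div_iff₀ hN').1 ht.1
    have h2 : (l : ℝ) < N := by simpa using (div_lt_iff₀ hN').1 ht.2
    exact ⟨by exact_mod_cast h1, by exact_mod_cast h2⟩
  rw [← (Nat.cast_injective (R := ℤ)).tsum_eq, tsum_eq_sum (s := Finset.range (N + 1))]
  · refine Finset.sum_congr rfl fun l hl => ?_
    rw [Finset.mem_range] at hl
    congr 2
    rw [Xvec]
    split_ifs with hb
    · rw [hsupp _ (by omega)]
    · have h1 : (0 : ℝ) < l := by exact_mod_cast (by omega : 0 < l)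
      have h2 : (l : ℝ) < N := by exact_mod_cast (by omega : l < N)
      rw [zeroExt_of_mem, Int.cast_natCast]
      rw [Int.cast_natCast]
      exact ⟨by positivity, (div_lt_one hN').2 h2⟩
  · intro l hl
    rw [Finset.mem_range] at hl
    rw [hsupp _ (by omega), Complex.ofReal_zero, mul_zero]
  · intro l hl
    rw [Function.mem_support] at hl
    have : 0 < l ∧ l < N := by
      by_contra hc
      exact hl (by rw [hsupp _ hc, Complex.ofReal_zero, mul_zero])
    exact ⟨l.toNat, by omega⟩

lemma zeroExt_sample_eq_zero (h : ℝ → ℝ) (N : ℕ) :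
    ∀ l : ℤ, l ∉ Finset.Icc (0 : ℤ) N → ((zeroExt h (l / N) : ℝ) : ℂ) = 0 := by
  intro l hl
  rw [zeroExt_of_notMem, Complex.ofReal_zero]
  intro ht
  rcases Nat.eq_zero_or_pos N with rfl | hN
  · simp at ht
  have hN' : (0 : ℝ) < N := by exact_mod_cast hN
  have h1 : (0 : ℝ) < l := by simpa using (lt_div_iff₀ hN').1 ht.1
  have h2 : (l : ℝ) < N := by simpa using (div_lt_iff₀ hN').1 ht.2
  exact hl (Finset.mem_Icc.2 ⟨by exact_mod_cast h1.le, by exact_mod_cast h2.le⟩)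

lemma rpow_mul_sum_eq_weight {α : ℝ} (x : ℝ) (h : ℝ → ℝ) (n : ℕ) {N : ℕ} (hN : 0 < N) :
    (((N : ℝ) ^ α : ℝ) : ℂ) * ∑ l ∈ Finset.range (N + 1),
        phiHat α (⌊(N : ℝ) * x⌋ - (l : ℤ)) * ((Xvec h N l : ℝ) : ℂ) =
      ∑ l ∈ Finset.Icc (-(n : ℤ)) (N + n), weight α x N l * ((zeroExt h (l / N) : ℝ) : ℂ) := by
  rw [sum_Xvec_eq_tsum (fun l => phiHat α (⌊(N : ℝ) * x⌋ - l)) h hN,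
    tsum_eq_sum (s := Finset.Icc (-(n : ℤ)) (N + n)), Finset.mul_sum]
  · exact Finset.sum_congr rfl fun l _ => by rw [weight, mul_assoc]
  · intro l hl
    rw [zeroExt_sample_eq_zero, mul_zero]
    rw [Finset.mem_Icc] at hl ⊢
    omega

lemma rpow_add_mul_sum_eq_weight {α : ℝ} (hα : 0 < α) (x : ℝ) (h : ℝ → ℝ) (n : ℕ) {N : ℕ}
    (hN : 0 < N) :
    (((N : ℝ) ^ (α + n) : ℝ) : ℂ) * ∑ l ∈ Finset.range (N + 1),
        phiHat (α + n) (⌊(N : ℝ) * x⌋ - (l : ℤ)) * ((Xvec h N l : ℝ) : ℂ) =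
      2 ^ n * ∑ l ∈ Finset.Icc (-(n : ℤ)) (N + n), weight α x N l *
        (((N / 2 : ℝ) ^ n * (centralDiff (1 / N))^[n] (zeroExt h) (l / N) : ℝ) : ℂ) := by
  have hN' : (0 : ℝ) < N := by exact_mod_cast hN
  rw [sum_Xvec_eq_tsum (fun l => phiHat (α + n) (⌊(N : ℝ) * x⌋ - l)) h hN,
    tsum_phiHat_add_nat hα _ n _ _ _ (zeroExt_sample_eq_zero h N),
    tsum_eq_sum (s := Finset.Icc (-(n : ℤ)) (N + n)), Finset.mul_sum, Finset.mul_sum]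
  · refine Finset.sum_congr rfl fun l _ => ?_
    rw [iterate_latticeDiff_sample, weight, Real.rpow_add hN', Real.rpow_natCast]
    push_cast
    rw [div_pow]
    field_simp
  · intro l hl
    rw [iterate_latticeDiff_eq_zero n _ _ _ (zeroExt_sample_eq_zero h N) l (by simpa using hl),
      mul_zero]

lemma MemL1Class.exists_bound {α : ℝ} (hα : 0 < α) {g : ℝ → ℝ} (hg : MemL1Class α g) :
    ∃ C γ a : ℝ, 0 ≤ C ∧ γ ∈ Set.Ico (0 : ℝ) 1 ∧ 0 < a ∧ a ≤ 1 ∧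
      (∀ t ∈ Set.Ioo 0 a, |g t| ≤ C * t ^ (-γ)) ∧
      ∀ t ∈ Set.Ioo 0 a, |g (1 - t)| ≤ C * t ^ (-γ) := by
  obtain ⟨γ, h0, h1, hl, hr⟩ := hg
  obtain ⟨c, hc, hl⟩ := hl.exists_pos
  obtain ⟨c', hc', hr⟩ := hr.exists_pos
  obtain ⟨a, ha, hsub⟩ := mem_nhdsGT_iff_exists_Ioo_subset.1 (hl.bound.and hr.bound)
  have ha : 0 < a := ha
  have key : ∀ t ∈ Set.Ioo 0 (min a 1), |g t| ≤ c * t ^ (-γ) ∧ |g (1 - t)| ≤ c' * t ^ (-γ) := by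
    intro t ht
    have := hsub ⟨ht.1, ht.2.trans_le (min_le_left _ _)⟩
    have hp := Real.rpow_nonneg ht.1.le (-γ)
    simpa only [Set.mem_ofPred_eq, Real.norm_eq_abs, abs_of_nonneg hp] using this
  refine ⟨max c c', γ, min a 1, hc.le.trans (le_max_left _ _), ⟨h0, by linarith⟩,
    lt_min ha one_pos, min_le_right _ _, fun t ht => (key t ht).1.trans ?_,
    fun t ht => (key t ht).2.trans ?_⟩
  · exact mul_le_mul_of_nonneg_right (le_max_left _ _) (Real.rpow_nonneg ht.1.le _)
  · exact mul_le_mul_of_nonneg_right (le_max_right _ _) (Real.rpow_nonneg ht.1.le _)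

lemma abs_sub_le_of_secant {u g : ℝ → ℝ} (hd : ∀ t ∈ Set.Ioo (0 : ℝ) 1, HasDerivAt u (g t) t)
    (hg : LocLip01 g) {n : ℕ} {Y : ℕ → ℤ → ℝ}
    (hY : ∀ N : ℕ, 0 < N → ∀ l : ℤ, ∃ ξ : ℝ, |ξ - l / N| + 1 / N ≤ n / N ∧
      Y N l = N / 2 * centralDiff (1 / N) u ξ) {a : ℝ} (ha : 0 < a) (ha' : a < 1 / 2) :
    ∃ K : ℝ, ∀ᶠ N : ℕ in atTop, ∀ l ∈ lattice a (1 - a) N,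
      |Y N l - zeroExt g (l / N)| ≤ K / N := by
  obtain ⟨K, hK⟩ := hg (a / 2) (1 - a / 2) (by linarith) (by linarith) (by linarith)
  refine ⟨|K| * n, ?_⟩
  filter_upwards [eventually_gt_atTop 0, (tendsto_natCast_atTop_atTop (R := ℝ)).eventually_ge_atTop
    (n / (a / 2))] with N hN hNn l hl
  have hN' : (0 : ℝ) < N := by exact_mod_cast hN
  have hna : (n : ℝ) / N ≤ a / 2 := by
    rw [div_le_iff₀ (by positivity)] at hNn
    rw [div_le_iff₀ hN']
    linarith
  rw [mem_lattice] at hl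
  have hl1 : a < (l : ℝ) / N := by rw [lt_div_iff₀ hN']; linarith
  have hl2 : (l : ℝ) / N ≤ 1 - a := by rw [div_le_iff₀ hN']; linarith
  obtain ⟨ξ, hξ, e⟩ := hY N hN l
  have h1 := abs_le.1 (by linarith : |ξ - l / N| ≤ n / N - 1 / N)
  obtain ⟨c, hc, e'⟩ := exists_centralDiff_eq (by positivity : (0 : ℝ) < 1 / N) (u := u) (g := g)
    (t := ξ) fun s hs => hd s ⟨by linarith [hs.1], by linarith [hs.2]⟩
  have h2 : |c - l / N| ≤ n / N := by linarith [abs_sub_le c ξ (l / N)]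
  have h3 := abs_le.1 h2
  have e2 : (N : ℝ) / 2 * (2 * (1 / N) * g c) = g c := by field_simp
  rw [e, e', e2, zeroExt_of_mem ⟨by linarith, by linarith⟩]
  calc |g c - g (l / N)| ≤ K * |c - l / N| :=
        hK _ ⟨by linarith, by linarith⟩ _ ⟨by linarith, by linarith⟩
    _ ≤ |K| * (n / N) := mul_le_mul (le_abs_self K) h2 (abs_nonneg _) (abs_nonneg _)
    _ = |K| * n / N := by ring

/-- For `f` `n` times differentiable with vanishing boundary derivatives up to order `n-1`
and `f^{(n)}` locally Lipschitz on `(0,1)` and in `L¹_{1-α}((0,1))`, both `D_{α+n}(f)(x)`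
and `D_α(f^{(n)})(x)` exist for `x ∈ (0,1)` and `D_{α+n}(f)(x) = 2^n D_α(f^{(n)})(x)`. -/
theorem fractional_derivative_composition (α : ℝ) (hα : α ∈ Set.Ioo (0 : ℝ) 1)
    (n : ℕ) (hn : 0 < n) (f : ℝ → ℝ)
    (hdiff : ∀ j < n, Differentiable ℝ (iteratedDeriv j f))
    (hbc : ∀ j < n, iteratedDeriv j f 0 = 0 ∧ iteratedDeriv j f 1 = 0)
    (hlip : LocLip01 (iteratedDeriv n f)) (hmem : MemL1Class α (iteratedDeriv n f))
    (x : ℝ) (hx : x ∈ Set.Ioo (0 : ℝ) 1) :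
    ∃ L : ℂ, HasDAt α (iteratedDeriv n f) x L ∧ HasDAt (α + n) f x ((2 : ℂ) ^ n * L) := by
  obtain ⟨M, rfl⟩ := Nat.exists_eq_succ_of_ne_zero hn.ne'
  set g := iteratedDeriv (M + 1) f with hg_def
  set u : ℕ → ℝ → ℝ := fun j => zeroExt (iteratedDeriv j f) with hu_def
  have hchain : ∀ j < M, ∀ t, HasDerivAt (u j) (u (j + 1) t) t := by
    intro j hj t
    have h0 := hbc (j + 1) (by omega)
    have := hasDerivAt_zeroExt (hdiff j (by omega)) (hbc j (by omega)).1 (hbc j (by omega)).2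
      (by rw [← iteratedDeriv_succ]; exact h0.1) (by rw [← iteratedDeriv_succ]; exact h0.2) t
    simpa only [hu_def, iteratedDeriv_succ] using this
  have hlast : ∀ t ∈ Set.Ioo (0 : ℝ) 1, HasDerivAt (u M) (g t) t := by
    intro t ht
    rw [hg_def, iteratedDeriv_succ]
    exact hasDerivAt_zeroExt_of_mem ht (hdiff M (by omega) t).hasDerivAt
  have hcont : Continuous (u M) :=
    continuous_zeroExt (hdiff M (by omega)).continuous (hbc M (by omega)).1 (hbc M (by omega)).2
  set Y : ℕ → ℤ → ℝ := fun N l =>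
    (N / 2 : ℝ) ^ (M + 1) * (centralDiff (1 / N))^[M + 1] (zeroExt f) (l / N) with hY_def
  have hY : ∀ N : ℕ, 0 < N → ∀ l : ℤ, ∃ ξ : ℝ, |ξ - l / N| + 1 / N ≤ (M + 1 : ℕ) / N ∧
      Y N l = N / 2 * centralDiff (1 / N) (u M) ξ := by
    intro N hN l
    have hN' : (0 : ℝ) < N := by exact_mod_cast hN
    obtain ⟨ξ, hξ, e⟩ := exists_iterate_centralDiff_eq (by positivity : (0 : ℝ) < 1 / N) M
      (fun j => centralDiff (1 / N) (u j)) (fun j hj t => ((hchain j hj _).comp_add_const t _).sub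
        ((hchain j hj _).comp_sub_const t _)) (l / N)
    refine ⟨ξ, ?_, ?_⟩
    · have : ((M + 1 : ℕ) : ℝ) / N = M * (1 / N) + 1 / N := by push_cast; ring
      linarith
    · have e0 : u 0 = zeroExt f := by simp only [hu_def, iteratedDeriv_zero]
      simp only [e0] at e
      simp only [hY_def]
      rw [Function.iterate_succ_apply, e, pow_succ]
      have : (N / 2 : ℝ) ^ M * (2 * (1 / N)) ^ M = 1 := by
        rw [← mul_pow]; field_simp; simp
      linear_combination N / 2 * centralDiff (1 / N) (u M) ξ * this
  obtain ⟨C, γ, a, hC, hγ, ha, ha1, hgl, hgr⟩ := hmem.exists_bound hα.1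
  have hYsmall : TailSmall (M + 1) Y := tailSmall_of_secant hC hγ.2 ha ha1 hcont
    (fun t ht => zeroExt_of_notMem ht) hlast hgl hgr hY
  have hGsmall : TailSmall (M + 1) fun N l => zeroExt g (l / N) :=
    tailSmall_zeroExt hC hγ ha hgl hgr hn
  obtain ⟨L, hL⟩ := exists_tendsto_of_tailSmall hα hx hGsmall hlip fun N l h1 h2 => by
    have hl : (0 : ℝ) < l := by exact_mod_cast h1
    have hl2 : (l : ℝ) < N := by exact_mod_cast h2
    have hN' : (0 : ℝ) < N := hl.trans hl2
    exact zeroExt_of_mem ⟨by positivity, (div_lt_one hN').2 hl2⟩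
  have hdiff0 := tendsto_zero_of_tailSmall hα hx (hYsmall.sub hGsmall)
    fun a ha ha' => abs_sub_le_of_secant hlast hlip hY ha ha'
  refine ⟨L, hL.congr' ?_, ((hdiff0.add hL).const_mul ((2 : ℂ) ^ (M + 1))).congr' ?_ |>.trans ?_⟩
  · filter_upwards [eventually_gt_atTop 0] with N hN
    exact (rpow_mul_sum_eq_weight x g (M + 1) hN).symm
  · filter_upwards [eventually_gt_atTop 0] with N hN
    rw [rpow_add_mul_sum_eq_weight hα.1 x f (M + 1) hN, ← Finset.sum_add_distrib]
    congr 1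
    refine Finset.sum_congr rfl fun l _ => ?_
    rw [← mul_add, ← Complex.ofReal_add, sub_add_cancel]
  · rw [zero_add]
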